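/- arXiv:0711.3905 — 4 statements merged into one kernel-verified Lean document; each statement's English description precedes it below -/
import Mathlib

section
/- Let h : ℝ → ℂ be a smooth function with compact support. Then ∫_ℝ |h′(x)|² (1 + x²) dx ≥ ∫_ℝ |h(x)|² / (1 + x²) dx. (This is the case n = 1 of the weighted Dirac inequality ∫‖Dh‖²(1+‖x‖²) ≥ n² ∫‖h‖²/(1+‖x‖²), realized through the identification Cl₁ ≅ ℂ, in which D = i·d/dx and ‖Dh‖ = |h′|.) -/
/-- The weighted Hardy-type inequality on `ℝ`: for `h : ℝ → ℂ` smooth with compact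
support, `∫ |h′(x)|² (1 + x²) dx ≥ ∫ |h(x)|² / (1 + x²) dx`.  (This is the case
`n = 1` of the sharp weighted Dirac inequality, under `Cl₁ ≅ ℂ`.) -/
theorem weighted_dirac_inequality_one_dim (h : ℝ → ℂ)
    (hsmooth : ContDiff ℝ (⊤ : ℕ∞) h) (hsupp : HasCompactSupport h) :
    ∫ x : ℝ, ‖deriv h x‖ ^ 2 * (1 + x ^ 2) ≥ ∫ x : ℝ, ‖h x‖ ^ 2 / (1 + x ^ 2) := by
  have hc : Continuous h := hsmooth.continuous
  have hd : Differentiable ℝ h := hsmooth.differentiable (by simp)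
  have hc' : Continuous (deriv h) := hsmooth.continuous_deriv (by simp)
  have hs' : HasCompactSupport (deriv h) := hsupp.deriv
  have pos : ∀ x : ℝ, 0 < 1 + x ^ 2 := fun x => by positivity
  have key : ∀ x, HasDerivAt (fun x : ℝ => x * ‖h x‖ ^ 2)
      (‖h x‖ ^ 2 + x * (2 * inner ℝ (h x) (deriv h x))) x := by
    intro x
    have := (hasDerivAt_id x).mul (hd x).hasDerivAt.norm_sq
    rw [one_mul] at this
    exact this
  have iF : MeasureTheory.Integrable (fun x : ℝ => x * ‖h x‖ ^ 2) := by
    apply Continuous.integrable_of_hasCompactSupport (by fun_prop)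
    exact hsupp.mono (fun x hx => by
      contrapose! hx
      simp_all)
  have iF' : MeasureTheory.Integrable
      (fun x : ℝ => ‖h x‖ ^ 2 + x * (2 * inner ℝ (h x) (deriv h x))) := by
    apply Continuous.integrable_of_hasCompactSupport (by fun_prop)
    exact hsupp.mono (fun x hx => by
      contrapose! hx
      simp_all)
  have iA : MeasureTheory.Integrable (fun x : ℝ => ‖deriv h x‖ ^ 2 * (1 + x ^ 2)) := by
    apply Continuous.integrable_of_hasCompactSupport (by fun_prop)
    exact hs'.mono (fun x hx => by
      contrapose! hx
      simp_all)
  have iB : MeasureTheory.Integrable (fun x : ℝ => ‖h x‖ ^ 2 / (1 + x ^ 2)) := by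
    apply Continuous.integrable_of_hasCompactSupport
    · exact (by fun_prop : Continuous fun x => ‖h x‖ ^ 2).div (by fun_prop)
        (fun x => (pos x).ne')
    exact hsupp.mono (fun x hx => by
      contrapose! hx
      simp_all)
  have z := MeasureTheory.integral_eq_zero_of_hasDerivAt_of_integrable key iF' iF
  have le : ∫ x : ℝ, (‖h x‖ ^ 2 / (1 + x ^ 2) -
        (‖h x‖ ^ 2 + x * (2 * inner ℝ (h x) (deriv h x)))) ≤
      ∫ x : ℝ, ‖deriv h x‖ ^ 2 * (1 + x ^ 2) := by
    refine MeasureTheory.integral_mono (iB.sub iF') iA (fun x => ?_)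
    have e := norm_add_sq_real (x • h x) ((1 + x ^ 2) • deriv h x)
    have n := sq_nonneg ‖x • h x + (1 + x ^ 2) • deriv h x‖
    rw [e, norm_smul, norm_smul, real_inner_smul_left, real_inner_smul_right, mul_pow, mul_pow,
      Real.norm_eq_abs, Real.norm_eq_abs, sq_abs, sq_abs] at n
    have p := pos x
    show ‖h x‖ ^ 2 / (1 + x ^ 2) - (‖h x‖ ^ 2 + x * (2 * inner ℝ (h x) (deriv h x))) ≤
      ‖deriv h x‖ ^ 2 * (1 + x ^ 2)
    rw [sub_le_iff_le_add, div_le_iff₀ p]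
    linarith
  rw [MeasureTheory.integral_sub iB iF', z, sub_zero] at le
  exact le
end

section
/- Let h : ℝ³ → ℍ be a smooth function with compact support. Then ∫_{ℝ³} ‖Dh(x)‖² (1 + ‖x‖²) dx ≥ 9 · ∫_{ℝ³} ‖h(x)‖² / (1 + ‖x‖²) dx. (This is the case n = 3 of the sharp weighted Dirac inequality ∫‖Dh‖²(1+‖x‖²) ≥ n² ∫‖h‖²/(1+‖x‖²).) -/
noncomputable section

/-- The quaternion `i`. -/
def qI : Quaternion ℝ := ⟨0, 1, 0, 0⟩

/-- The quaternion `j`. -/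
def qJ : Quaternion ℝ := ⟨0, 0, 1, 0⟩

/-- The quaternion `k`. -/
def qK : Quaternion ℝ := ⟨0, 0, 0, 1⟩

/-- The Dirac (Moisil–Teodorescu) operator
`Dh(x) = i·(∂h/∂x₁)(x) + j·(∂h/∂x₂)(x) + k·(∂h/∂x₃)(x)` on quaternion-valued
functions on `ℝ³`, using left quaternionic multiplication. -/
def diracQ (h : EuclideanSpace ℝ (Fin 3) → Quaternion ℝ) :
    EuclideanSpace ℝ (Fin 3) → Quaternion ℝ := fun x =>
  qI * fderiv ℝ h x (EuclideanSpace.single 0 1) +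
    qJ * fderiv ℝ h x (EuclideanSpace.single 1 1) +
    qK * fderiv ℝ h x (EuclideanSpace.single 2 1)

abbrev E3 := EuclideanSpace ℝ (Fin 3)

def bas (i : Fin 3) : E3 := EuclideanSpace.single i 1

def ZI (φ : E3 → ℝ) : Prop := MeasureTheory.Integrable φ ∧ ∫ x, φ x = 0

lemma ZI.add {φ ψ : E3 → ℝ} (h1 : ZI φ) (h2 : ZI ψ) : ZI (fun x => φ x + ψ x) :=
  ⟨h1.1.add h2.1, by rw [MeasureTheory.integral_add h1.1 h2.1, h1.2, h2.2, add_zero]⟩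

lemma ZI.sub {φ ψ : E3 → ℝ} (h1 : ZI φ) (h2 : ZI ψ) : ZI (fun x => φ x - ψ x) :=
  ⟨h1.1.sub h2.1, by rw [MeasureTheory.integral_sub h1.1 h2.1, h1.2, h2.2, sub_zero]⟩

lemma ZI.cmul {φ : E3 → ℝ} (h1 : ZI φ) (c : ℝ) : ZI (fun x => c * φ x) :=
  ⟨h1.1.const_mul c, by rw [MeasureTheory.integral_const_mul, h1.2, mul_zero]⟩

lemma ZI_fderiv {φ : E3 → ℝ} (hφ : ContDiff ℝ 1 φ) (hs : HasCompactSupport φ) (v : E3) :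
    ZI (fun x => fderiv ℝ φ x v) := by
  have hc : Continuous (fun x => fderiv ℝ φ x v) :=
    (hφ.continuous_fderiv one_ne_zero).clm_apply continuous_const
  have hi : MeasureTheory.Integrable (fun x => fderiv ℝ φ x v) :=
    hc.integrable_of_hasCompactSupport (hs.fderiv_apply (𝕜 := ℝ) v)
  refine ⟨hi, ?_⟩
  have := integral_mul_fderiv_eq_neg_fderiv_mul_of_integrable (𝕜 := ℝ)
    (μ := (MeasureTheory.volume : MeasureTheory.Measure E3)) (f := fun _ => (1:ℝ)) (g := φ) (v := v)
    (by simp) (by simpa using hi)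
    (by simpa using hφ.continuous.integrable_of_hasCompactSupport hs)
    (fun x _ => by fun_prop) (fun x _ => (hφ.differentiable one_ne_zero) x)
  simpa using this

lemma fderiv_w (x : E3) (i : Fin 3) :
    fderiv ℝ (fun y : E3 => 1 + ‖y‖ ^ 2) x (bas i) = 2 * x i := by
  rw [fderiv_const_add]
  simp [bas, EuclideanSpace.inner_single_right]

lemma fderiv_coord (x : E3) (i j : Fin 3) :
    fderiv ℝ (fun y : E3 => y i) x (bas j) = if i = j then 1 else 0 := by
  have : (fun y : E3 => y i) = fun y => (EuclideanSpace.proj (𝕜 := ℝ) i : E3 →L[ℝ] ℝ) y := by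
    ext y; simp
  rw [this, ContinuousLinearMap.fderiv]
  simp [bas]

lemma ZI_sq {f : E3 → ℝ} (hf : ContDiff ℝ 2 f) (hs : HasCompactSupport f) (i : Fin 3) :
    ZI (fun x => f x ^ 2 + 2 * x i * f x * fderiv ℝ f x (bas i)) := by
  have h1 : ContDiff ℝ 1 f := hf.of_le (by norm_num)
  have hd : Differentiable ℝ f := h1.differentiable one_ne_zero
  have hx : ContDiff ℝ 1 (fun y : E3 => y i) := by fun_prop
  have := ZI_fderiv (φ := fun y => y i * (f y * f y)) (hx.mul (h1.mul h1))
    ((hs.mul_left (f := f)).mul_left) (bas i)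
  convert this using 2 with x
  rw [fderiv_fun_mul (by fun_prop) (by fun_prop), fderiv_fun_mul (by fun_prop) (by fun_prop)]
  simp [fderiv_coord]
  ring

lemma ZI_half {f g : E3 → ℝ} (hf : ContDiff ℝ 2 f) (hg : ContDiff ℝ 2 g)
    (hs : HasCompactSupport f) (i j : Fin 3) :
    ZI (fun x => (1 + ‖x‖ ^ 2) * (fderiv ℝ f x (bas i) * fderiv ℝ g x (bas j)
      + f x * fderiv ℝ (fderiv ℝ g) x (bas i) (bas j))
      + 2 * x i * f x * fderiv ℝ g x (bas j)) := by
  have h1 : ContDiff ℝ 1 f := hf.of_le (by norm_num)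
  have hd : Differentiable ℝ f := h1.differentiable one_ne_zero
  have hg1 : ContDiff ℝ 1 (fderiv ℝ g) := hg.fderiv_right (by norm_num)
  have hg2 : ContDiff ℝ 1 (fun y => fderiv ℝ g y (bas j)) := hg1.clm_apply contDiff_const
  have hgd : Differentiable ℝ (fun y => fderiv ℝ g y (bas j)) := hg2.differentiable one_ne_zero
  have hw : ContDiff ℝ 1 (fun y : E3 => 1 + ‖y‖ ^ 2) := contDiff_const.add (contDiff_norm_sq ℝ)
  have hwd : Differentiable ℝ (fun y : E3 => 1 + ‖y‖ ^ 2) := hw.differentiable one_ne_zero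
  have := ZI_fderiv (φ := fun y => (1 + ‖y‖ ^ 2) * (f y * fderiv ℝ g y (bas j)))
    (hw.mul (h1.mul hg2)) ((hs.mul_right).mul_left) (bas i)
  convert this using 2 with x
  rw [fderiv_fun_mul (hwd x) ((hd x).fun_mul (hgd x)), fderiv_fun_mul (hd x) (hgd x)]
  have e : fderiv ℝ (fun y => fderiv ℝ g y (bas j)) x (bas i)
      = fderiv ℝ (fderiv ℝ g) x (bas i) (bas j) := by
    rw [fderiv_clm_apply ((hg1.differentiable one_ne_zero) x) (by fun_prop)]
    simp
  simp only [ContinuousLinearMap.add_apply, ContinuousLinearMap.smul_apply, smul_eq_mul, fderiv_w, e]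
  ring

lemma ZI_L {f g : E3 → ℝ} (hf : ContDiff ℝ 2 f) (hg : ContDiff ℝ 2 g)
    (hs : HasCompactSupport f) (i j : Fin 3) :
    ZI (fun x => (1 + ‖x‖ ^ 2) * (fderiv ℝ f x (bas i) * fderiv ℝ g x (bas j)
      - fderiv ℝ f x (bas j) * fderiv ℝ g x (bas i))
      + 2 * f x * (x i * fderiv ℝ g x (bas j) - x j * fderiv ℝ g x (bas i))) := by
  convert (ZI_half hf hg hs i j).sub (ZI_half hf hg hs j i) using 2 with x
  have : fderiv ℝ (fderiv ℝ g) x (bas i) (bas j) = fderiv ℝ (fderiv ℝ g) x (bas j) (bas i) :=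
    (hg.contDiffAt.isSymmSndFDerivAt (by simp)).eq _ _
  rw [this]
  ring

lemma ZI_LL {f g : E3 → ℝ} (hf : ContDiff ℝ 2 f) (hg : ContDiff ℝ 2 g)
    (hs : HasCompactSupport f) (hs' : HasCompactSupport g) (i j : Fin 3) :
    ZI (fun x => (1 + ‖x‖ ^ 2) * (2 * (fderiv ℝ f x (bas i) * fderiv ℝ g x (bas j)
      - fderiv ℝ f x (bas j) * fderiv ℝ g x (bas i)))
      + 2 * f x * (x i * fderiv ℝ g x (bas j) - x j * fderiv ℝ g x (bas i))
      - 2 * g x * (x i * fderiv ℝ f x (bas j) - x j * fderiv ℝ f x (bas i))) := by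
  convert (ZI_L hf hg hs i j).sub (ZI_L hg hf hs' i j) using 2 with x
  ring

lemma qnorm (q : Quaternion ℝ) : ‖q‖ ^ 2 = q.re ^ 2 + q.imI ^ 2 + q.imJ ^ 2 + q.imK ^ 2 := by
  rw [← Quaternion.normSq_def', Quaternion.normSq_eq_norm_mul_self, sq]

@[simp] lemma qI_re : qI.re = 0 := rfl
@[simp] lemma qI_imI : qI.imI = 1 := rfl
@[simp] lemma qI_imJ : qI.imJ = 0 := rfl
@[simp] lemma qI_imK : qI.imK = 0 := rfl
@[simp] lemma qJ_re : qJ.re = 0 := rfl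
@[simp] lemma qJ_imI : qJ.imI = 0 := rfl
@[simp] lemma qJ_imJ : qJ.imJ = 1 := rfl
@[simp] lemma qJ_imK : qJ.imK = 0 := rfl
@[simp] lemma qK_re : qK.re = 0 := rfl
@[simp] lemma qK_imI : qK.imI = 0 := rfl
@[simp] lemma qK_imJ : qK.imJ = 0 := rfl
@[simp] lemma qK_imK : qK.imK = 1 := rfl

lemma qnorm_le (a b c : Quaternion ℝ) :
    ‖qI * a + qJ * b + qK * c‖ ^ 2 ≤ 3 * (‖a‖ ^ 2 + ‖b‖ ^ 2 + ‖c‖ ^ 2) := by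
  have hI : ‖qI‖ = 1 := by
    have := qnorm qI
    simp only [qI_re, qI_imI, qI_imJ, qI_imK] at this
    nlinarith [norm_nonneg qI]
  have hJ : ‖qJ‖ = 1 := by
    have := qnorm qJ
    simp only [qJ_re, qJ_imI, qJ_imJ, qJ_imK] at this
    nlinarith [norm_nonneg qJ]
  have hK : ‖qK‖ = 1 := by
    have := qnorm qK
    simp only [qK_re, qK_imI, qK_imJ, qK_imK] at this
    nlinarith [norm_nonneg qK]
  have h : ‖qI * a + qJ * b + qK * c‖ ≤ ‖a‖ + ‖b‖ + ‖c‖ := by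
    refine (norm_add₃_le).trans ?_
    simp [hI, hJ, hK]
  have h2 : ‖qI * a + qJ * b + qK * c‖ ^ 2 ≤ (‖a‖ + ‖b‖ + ‖c‖) ^ 2 := by gcongr
  nlinarith [sq_nonneg (‖a‖ - ‖b‖), sq_nonneg (‖b‖ - ‖c‖), sq_nonneg (‖a‖ - ‖c‖)]

/-- The pointwise inequality. -/
lemma pointwise (h a b c : Quaternion ℝ) (x y z w : ℝ) (hw : w = 1 + (x ^ 2 + y ^ 2 + z ^ 2)) :
    9 * (‖h‖ ^ 2 / w) + (3 / 2) * (
      (w * (2 * (a.re * b.imK - b.re * a.imK)) + 2 * h.re * (x * b.imK - y * a.imK)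
        - 2 * h.imK * (x * b.re - y * a.re))
      + (w * (2 * (a.imI * b.imJ - b.imI * a.imJ)) + 2 * h.imI * (x * b.imJ - y * a.imJ)
        - 2 * h.imJ * (x * b.imI - y * a.imI))
      + (w * (2 * (b.re * c.imI - c.re * b.imI)) + 2 * h.re * (y * c.imI - z * b.imI)
        - 2 * h.imI * (y * c.re - z * b.re))
      + (w * (2 * (b.imJ * c.imK - c.imJ * b.imK)) + 2 * h.imJ * (y * c.imK - z * b.imK)
        - 2 * h.imK * (y * c.imJ - z * b.imJ))
      + (w * (2 * (a.imJ * c.re - c.imJ * a.re)) + 2 * h.imJ * (x * c.re - z * a.re)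
        - 2 * h.re * (x * c.imJ - z * a.imJ))
      + (w * (2 * (a.imI * c.imK - c.imI * a.imK)) + 2 * h.imI * (x * c.imK - z * a.imK)
        - 2 * h.imK * (x * c.imI - z * a.imI)))
      - 3 * (
        ((h.re ^ 2 + 2 * x * h.re * a.re) + (h.re ^ 2 + 2 * y * h.re * b.re)
          + (h.re ^ 2 + 2 * z * h.re * c.re))
        + ((h.imI ^ 2 + 2 * x * h.imI * a.imI) + (h.imI ^ 2 + 2 * y * h.imI * b.imI)
          + (h.imI ^ 2 + 2 * z * h.imI * c.imI))
        + ((h.imJ ^ 2 + 2 * x * h.imJ * a.imJ) + (h.imJ ^ 2 + 2 * y * h.imJ * b.imJ)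
          + (h.imJ ^ 2 + 2 * z * h.imJ * c.imJ))
        + ((h.imK ^ 2 + 2 * x * h.imK * a.imK) + (h.imK ^ 2 + 2 * y * h.imK * b.imK)
          + (h.imK ^ 2 + 2 * z * h.imK * c.imK)))
      ≤ ‖qI * a + qJ * b + qK * c‖ ^ 2 * w := by
  have hw0 : 0 < w := by rw [hw]; positivity
  obtain ⟨q, rfl⟩ : ∃ q : Quaternion ℝ, h = w • q := ⟨w⁻¹ • h, by rw [smul_inv_smul₀ hw0.ne']⟩
  have key := qnorm_le (a + (3 * x) • q) (b + (3 * y) • q) (c + (3 * z) • q)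
  have key2 := mul_le_mul_of_nonneg_left key hw0.le
  have e : ‖w • q‖ ^ 2 / w = w * ‖q‖ ^ 2 := by
    rw [norm_smul, mul_pow, Real.norm_eq_abs, sq_abs]
    field_simp
  rw [e]
  rw [← sub_nonneg] at key2 ⊢
  refine le_of_le_of_eq (mul_nonneg (by norm_num : (0:ℝ) ≤ 1 / 2) key2) ?_
  simp only [qnorm, qI_re, qI_imI, qI_imJ, qI_imK, qJ_re, qJ_imI, qJ_imJ, qJ_imK, qK_re, qK_imI, qK_imJ, qK_imK,
    Quaternion.re_add, Quaternion.imI_add, Quaternion.imJ_add,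
    Quaternion.imK_add, Quaternion.re_mul, Quaternion.imI_mul, Quaternion.imJ_mul,
    Quaternion.imK_mul, Quaternion.re_smul, Quaternion.imI_smul, Quaternion.imJ_smul,
    Quaternion.imK_smul, smul_eq_mul]
  subst hw
  ring

def cRe : Quaternion ℝ →L[ℝ] ℝ :=
  LinearMap.toContinuousLinearMap
    { toFun := fun q => q.re, map_add' := fun _ _ => rfl, map_smul' := fun _ _ => rfl }
def cI : Quaternion ℝ →L[ℝ] ℝ :=
  LinearMap.toContinuousLinearMap
    { toFun := fun q => q.imI, map_add' := fun _ _ => rfl, map_smul' := fun _ _ => rfl }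
def cJ : Quaternion ℝ →L[ℝ] ℝ :=
  LinearMap.toContinuousLinearMap
    { toFun := fun q => q.imJ, map_add' := fun _ _ => rfl, map_smul' := fun _ _ => rfl }
def cK : Quaternion ℝ →L[ℝ] ℝ :=
  LinearMap.toContinuousLinearMap
    { toFun := fun q => q.imK, map_add' := fun _ _ => rfl, map_smul' := fun _ _ => rfl }

lemma comp_facts (L : Quaternion ℝ →L[ℝ] ℝ) (h : E3 → Quaternion ℝ)
    (hsmooth : ContDiff ℝ (⊤ : ℕ∞) h) (hsupp : HasCompactSupport h) :
    ContDiff ℝ 2 (fun x => L (h x)) ∧ HasCompactSupport (fun x => L (h x)) ∧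
    ∀ x v, fderiv ℝ (fun x => L (h x)) x v = L (fderiv ℝ h x v) := by
  have h2 : ContDiff ℝ 2 h := by exact_mod_cast contDiff_infty.1 hsmooth 2
  refine ⟨L.contDiff.comp h2, hsupp.comp_left (g := L) (map_zero L), fun x v => ?_⟩
  have := (L.hasFDerivAt.comp x ((h2.differentiable (by norm_num)) x).hasFDerivAt).fderiv
  change fderiv ℝ (L ∘ h) x v = _
  rw [this]; rfl

/-- The sharp weighted Dirac inequality in `ℝ³`: for `h : ℝ³ → ℍ` smooth with compact
support, `∫ ‖Dh(x)‖² (1 + ‖x‖²) dx ≥ 9 ∫ ‖h(x)‖² / (1 + ‖x‖²) dx`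
(the case `n = 3` of `∫‖Dh‖²(1+‖x‖²) ≥ n² ∫‖h‖²/(1+‖x‖²)`). -/
theorem weighted_dirac_inequality_R3 (h : EuclideanSpace ℝ (Fin 3) → Quaternion ℝ)
    (hsmooth : ContDiff ℝ (⊤ : ℕ∞) h) (hsupp : HasCompactSupport h) :
    ∫ x, ‖diracQ h x‖ ^ 2 * (1 + ‖x‖ ^ 2) ≥ 9 * ∫ x, ‖h x‖ ^ 2 / (1 + ‖x‖ ^ 2) := by
  obtain ⟨r1, r2, r3⟩ := comp_facts cRe h hsmooth hsupp
  obtain ⟨i1, i2, i3⟩ := comp_facts cI h hsmooth hsupp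
  obtain ⟨j1, j2, j3⟩ := comp_facts cJ h hsmooth hsupp
  obtain ⟨k1, k2, k3⟩ := comp_facts cK h hsmooth hsupp
  have sq3 : ∀ {f : E3 → ℝ}, ContDiff ℝ 2 f → HasCompactSupport f → _ := fun {f} hf hs =>
    ((ZI_sq hf hs 0).add (ZI_sq hf hs 1)).add (ZI_sq hf hs 2)
  have A := (((((ZI_LL r1 k1 r2 k2 0 1).add (ZI_LL i1 j1 i2 j2 0 1)).add
    (ZI_LL r1 i1 r2 i2 1 2)).add (ZI_LL j1 k1 j2 k2 1 2)).add
    (ZI_LL j1 r1 j2 r2 0 2)).add (ZI_LL i1 k1 i2 k2 0 2)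
  have B := (((sq3 r1 r2).add (sq3 i1 i2)).add (sq3 j1 j2)).add (sq3 k1 k2)
  have G1 := A.cmul (3 / 2)
  have G2 := B.cmul 3
  have h1 : ContDiff ℝ 1 h := by exact_mod_cast contDiff_infty.1 hsmooth 1
  have hw : Continuous (fun x : E3 => 1 + ‖x‖ ^ 2) := by fun_prop
  have int1 : MeasureTheory.Integrable (fun x : E3 => ‖h x‖ ^ 2 / (1 + ‖x‖ ^ 2)) := by
    refine Continuous.integrable_of_hasCompactSupport
      ((h1.continuous.norm.pow 2).div hw (fun x => by positivity)) ?_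
    refine hsupp.mono ?_
    intro x hx hx'
    apply hx
    simp [show h x = 0 from hx']
  have hD : ∀ v, Continuous (fun x => fderiv ℝ h x v) := fun v =>
    (h1.continuous_fderiv one_ne_zero).clm_apply continuous_const
  have int2 : MeasureTheory.Integrable (fun x : E3 => ‖diracQ h x‖ ^ 2 * (1 + ‖x‖ ^ 2)) := by
    refine Continuous.integrable_of_hasCompactSupport ?_ ?_
    · refine Continuous.mul (Continuous.pow (Continuous.norm ?_) 2) hw
      exact ((continuous_const.mul (hD _)).add (continuous_const.mul (hD _))).add
        (continuous_const.mul (hD _))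
    · refine (hsupp.fderiv (𝕜 := ℝ)).mono ?_
      intro x hx hx'
      apply hx
      simp [diracQ, show fderiv ℝ h x = 0 from hx']
  have main := MeasureTheory.integral_mono (((int1.const_mul 9).add G1.1).sub G2.1) int2 (by
    intro x
    have := pointwise (h x) (fderiv ℝ h x (bas 0)) (fderiv ℝ h x (bas 1)) (fderiv ℝ h x (bas 2))
      (x 0) (x 1) (x 2) (1 + ‖x‖ ^ 2) (by
        rw [EuclideanSpace.norm_sq_eq, Fin.sum_univ_three]; simp)
    simp only [Pi.sub_apply, Pi.add_apply, r3, i3, j3, k3]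
    exact this)
  have e1 : ∀ {f g k : E3 → ℝ}, MeasureTheory.Integrable f → ZI g → ZI k →
      ∫ x, (f + g - k) x = ∫ x, f x := fun {f g k} hf hg hk => by
    rw [MeasureTheory.integral_sub' (hf.add hg.1) hk.1, MeasureTheory.integral_add' hf hg.1,
      hg.2, hk.2]; simp
  have e2 := e1 (int1.const_mul 9) G1 G2
  rw [MeasureTheory.integral_const_mul] at e2
  exact e2.symm.le.trans main

end
end

section
/- Let n ≥ 3, let F be a finite-dimensional real inner product space, and let h : ℝⁿ → F be a smooth function with compact support. Then (∫_{ℝⁿ} ‖Δh(x)‖² (1 + ‖x‖²)² dx)^{1/2} ≥ n(n−2) · (∫_{ℝⁿ} ‖h(x)‖² / (1 + ‖x‖²)² dx)^{1/2}, where Δh = Σ_{j=1}^n ∂²h/∂xⱼ² is the Laplacian. -/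
noncomputable section

/-- The componentwise Laplacian `Δh(x) = Σⱼ (∂²h/∂xⱼ²)(x)` of a function
`h : ℝⁿ → F`. -/
def laplacian {n : ℕ} {F : Type*} [NormedAddCommGroup F] [NormedSpace ℝ F]
    (h : EuclideanSpace ℝ (Fin n) → F) : EuclideanSpace ℝ (Fin n) → F := fun x =>
  ∑ j : Fin n,
    fderiv ℝ (fun y => fderiv ℝ h y (EuclideanSpace.single j 1)) x
      (EuclideanSpace.single j 1)

lemma wli_int_zero {n : ℕ} (g : EuclideanSpace ℝ (Fin n) → ℝ) (hg : ContDiff ℝ 1 g)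
    (hs : HasCompactSupport g) (v : EuclideanSpace ℝ (Fin n)) :
    MeasureTheory.Integrable (fun x => fderiv ℝ g x v) ∧ ∫ x, fderiv ℝ g x v = 0 := by
  have hc : Continuous (fun x => fderiv ℝ g x v) :=
    (hg.continuous_fderiv one_ne_zero).clm_apply continuous_const
  have hi : MeasureTheory.Integrable (fun x => fderiv ℝ g x v) :=
    hc.integrable_of_hasCompactSupport (hs.fderiv_apply (𝕜 := ℝ) v)
  refine ⟨hi, ?_⟩
  have := integral_mul_fderiv_eq_neg_fderiv_mul_of_integrable (𝕜 := ℝ)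
    (μ := MeasureTheory.volume) (f := fun _ : EuclideanSpace ℝ (Fin n) => (1 : ℝ)) (g := g) (v := v)
    (by simp) (by simpa using hi)
    (by simpa using hg.continuous.integrable_of_hasCompactSupport hs)
    (fun _ _ => by fun_prop) (fun x _ => hg.differentiable one_ne_zero x)
  simpa using this

lemma wli_deriv {n : ℕ} {F : Type*}
    [NormedAddCommGroup F] [InnerProductSpace ℝ F]
    (h : EuclideanSpace ℝ (Fin n) → F)
    (hsmooth : ContDiff ℝ (⊤ : ℕ∞) h) (c : ℝ) (j : Fin n) (x : EuclideanSpace ℝ (Fin n)) :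
    fderiv ℝ (fun y => inner ℝ (fderiv ℝ h y (EuclideanSpace.single j 1)) (h y) +
      c * (y j) / (1 + ‖y‖ ^ 2) * inner ℝ (h y) (h y)) x (EuclideanSpace.single j 1)
    = inner ℝ (fderiv ℝ (fun y => fderiv ℝ h y (EuclideanSpace.single j 1)) x
      (EuclideanSpace.single j 1)) (h x) + ‖fderiv ℝ h x (EuclideanSpace.single j 1)‖ ^ 2
      + c * (1 / (1 + ‖x‖ ^ 2) - 2 * x j ^ 2 / (1 + ‖x‖ ^ 2) ^ 2) * ‖h x‖ ^ 2
      + 2 * (c * (x j) / (1 + ‖x‖ ^ 2)) * inner ℝ (fderiv ℝ h x (EuclideanSpace.single j 1)) (h x)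
      := by
  set e : EuclideanSpace ℝ (Fin n) := EuclideanSpace.single j 1 with he
  have hD : ContDiff ℝ 1 (fun y => fderiv ℝ h y e) :=
    (hsmooth.fderiv_right (m := 1) (by norm_cast)).clm_apply contDiff_const
  have h1 : HasFDerivAt h (fderiv ℝ h x) x :=
    (hsmooth.differentiable (by simp) x).hasFDerivAt
  have h2 := (hD.differentiable one_ne_zero x).hasFDerivAt
  have hp : HasFDerivAt (fun y : EuclideanSpace ℝ (Fin n) => y j)
      (EuclideanSpace.proj j : EuclideanSpace ℝ (Fin n) →L[ℝ] ℝ) x :=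
    (EuclideanSpace.proj (𝕜 := ℝ) j).hasFDerivAt
  have hq : HasFDerivAt (fun y : EuclideanSpace ℝ (Fin n) => ‖y‖ ^ 2) _ x :=
    (hasStrictFDerivAt_norm_sq x).hasFDerivAt
  have hpos : (1 + ‖x‖ ^ 2) ≠ 0 := by positivity
  have hw := (hp.const_mul c).mul ((hasDerivAt_inv hpos).comp_hasFDerivAt x (hq.const_add 1))
  have htot := (h2.inner ℝ h1).add (hw.mul (h1.inner ℝ h1))
  have hf := htot.fderiv
  have hf2 := congrArg (fun L => L e) hf
  have hxe : inner ℝ x e = x j := by simp [he, EuclideanSpace.inner_single_right]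
  have hee : e j = 1 := by simp [he]
  simp only [div_eq_mul_inv (_ * _)]
  refine Eq.trans ?_ (hf2.trans ?_)
  · rfl
  · simp [hxe, hee, fderivInnerCLM_apply]
    rw [real_inner_comm (fderiv ℝ h x e) (h x)]
    field_simp
    ring

theorem weighted_laplacian_inequality (n : ℕ) (hn : 3 ≤ n) (F : Type*)
    [NormedAddCommGroup F] [InnerProductSpace ℝ F] [FiniteDimensional ℝ F]
    (h : EuclideanSpace ℝ (Fin n) → F)
    (hsmooth : ContDiff ℝ (⊤ : ℕ∞) h) (hsupp : HasCompactSupport h) :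
    Real.sqrt (∫ x, ‖laplacian h x‖ ^ 2 * (1 + ‖x‖ ^ 2) ^ 2) ≥
      (n : ℝ) * ((n : ℝ) - 2) * Real.sqrt (∫ x, ‖h x‖ ^ 2 / (1 + ‖x‖ ^ 2) ^ 2) := by
  have hn' : (3 : ℝ) ≤ n := by exact_mod_cast hn
  set c : ℝ := (n : ℝ) * ((n : ℝ) - 2) with hc
  have hcpos : 0 < c := by apply mul_pos <;> linarith
  have hD : ∀ e, ContDiff ℝ 1 (fun y => fderiv ℝ h y e) := fun e =>
    (hsmooth.fderiv_right (m := 1) (by norm_cast)).clm_apply contDiff_const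
  have hh1 : ContDiff ℝ 1 h := hsmooth.of_le (by norm_cast)
  let g : Fin n → EuclideanSpace ℝ (Fin n) → ℝ := fun j y =>
    inner ℝ (fderiv ℝ h y (EuclideanSpace.single j 1)) (h y) +
      ((n : ℝ) - 2) * (y j) / (1 + ‖y‖ ^ 2) * inner ℝ (h y) (h y)
  have hg : ∀ j, ContDiff ℝ 1 (g j) := by
    intro j
    refine ((hD _).inner ℝ hh1).add (ContDiff.mul (ContDiff.div ?_ ?_ ?_) (hh1.inner ℝ hh1))
    · exact contDiff_const.mul (EuclideanSpace.proj (𝕜 := ℝ) j).contDiff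
    · exact contDiff_const.add (contDiff_norm_sq ℝ)
    · intro x; positivity
  have hgs : ∀ j, HasCompactSupport (g j) := by
    intro j
    refine hsupp.mono ?_
    intro x hx hx0
    exact hx (by simp [g, hx0])
  have hlapc : Continuous (laplacian h) := by
    unfold laplacian
    exact continuous_finsetSum _ fun j _ =>
      ((hD _).continuous_fderiv one_ne_zero).clm_apply continuous_const
  have hlaps : HasCompactSupport (laplacian h) := by
    refine hsupp.of_isClosed_subset (isClosed_tsupport _) ?_
    refine closure_minimal ?_ (isClosed_tsupport _)
    intro x hx
    by_contra hx'
    apply hx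
    have h0 : ∀ j, fderiv ℝ (fun y => fderiv ℝ h y (EuclideanSpace.single j 1)) x = 0 := by
      intro j
      by_contra hne
      apply hx'
      have h1 := tsupport_fderiv_subset ℝ (subset_tsupport _ (show x ∈ Function.support _ from hne))
      exact tsupport_fderiv_apply_subset ℝ _ h1
    simp [laplacian, h0]
  have hA : MeasureTheory.Integrable (fun x => ‖laplacian h x‖ ^ 2 * (1 + ‖x‖ ^ 2) ^ 2) := by
    refine Continuous.integrable_of_hasCompactSupport (by fun_prop) ?_
    refine hlaps.mono ?_
    intro x hx hx0
    exact hx (by simp [hx0])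
  have hB : MeasureTheory.Integrable (fun x => ‖h x‖ ^ 2 / (1 + ‖x‖ ^ 2) ^ 2) := by
    have := hh1.continuous
    refine Continuous.integrable_of_hasCompactSupport
      (Continuous.div (by fun_prop) (by fun_prop) (fun x => by positivity)) ?_
    refine hsupp.mono ?_
    intro x hx hx0
    exact hx (by simp [hx0])
  have hGi : MeasureTheory.Integrable
      (fun x => ∑ j, fderiv ℝ (g j) x (EuclideanSpace.single j 1)) :=
    MeasureTheory.integrable_finsetSum _ fun j _ => (wli_int_zero (g j) (hg j) (hgs j) _).1
  have hG0 : ∫ x, ∑ j, fderiv ℝ (g j) x (EuclideanSpace.single j 1) = 0 := by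
    rw [MeasureTheory.integral_finsetSum _
      fun j _ => (wli_int_zero (g j) (hg j) (hgs j) _).1]
    exact Finset.sum_eq_zero fun j _ => (wli_int_zero (g j) (hg j) (hgs j) _).2
  have key : ∀ x, c ^ 2 * (‖h x‖ ^ 2 / (1 + ‖x‖ ^ 2) ^ 2) ≤
      ‖laplacian h x‖ ^ 2 * (1 + ‖x‖ ^ 2) ^ 2
      + 2 * c * ∑ j, fderiv ℝ (g j) x (EuclideanSpace.single j 1) := by
    intro x
    have hpos : 0 < 1 + ‖x‖ ^ 2 := by positivity
    have hx2 : ‖x‖ ^ 2 = ∑ j, x j ^ 2 := by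
      simp [EuclideanSpace.norm_sq_eq]
    have hsum : inner ℝ (laplacian h x) (h x) + c * (‖h x‖ ^ 2 / (1 + ‖x‖ ^ 2) ^ 2)
        ≤ ∑ j, fderiv ℝ (g j) x (EuclideanSpace.single j 1) := by
      have e1 : inner ℝ (laplacian h x) (h x) + c * (‖h x‖ ^ 2 / (1 + ‖x‖ ^ 2) ^ 2)
          = ∑ j, (inner ℝ (fderiv ℝ (fun y => fderiv ℝ h y (EuclideanSpace.single j 1)) x
              (EuclideanSpace.single j 1)) (h x)
            + (((n : ℝ) - 2) / (1 + ‖x‖ ^ 2) * ‖h x‖ ^ 2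
            - (2 * ((n : ℝ) - 2) + ((n : ℝ) - 2) ^ 2) / (1 + ‖x‖ ^ 2) ^ 2 * ‖h x‖ ^ 2
              * x j ^ 2)) := by
        rw [Finset.sum_add_distrib, Finset.sum_sub_distrib, ← Finset.mul_sum, ← Finset.mul_sum, ← hx2,
          laplacian, sum_inner]
        simp only [Finset.sum_const, Finset.card_univ, Fintype.card_fin, nsmul_eq_mul]
        congr 1
        rw [hc]
        field_simp
        ring
      rw [e1]
      refine Finset.sum_le_sum fun j _ => ?_
      rw [wli_deriv h hsmooth ((n : ℝ) - 2) j x]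
      have hsq := sq_nonneg ‖fderiv ℝ h x (EuclideanSpace.single j 1)
        + (((n : ℝ) - 2) * x j / (1 + ‖x‖ ^ 2)) • h x‖
      rw [norm_add_sq_real, inner_smul_right, norm_smul, mul_pow, Real.norm_eq_abs, sq_abs] at hsq
      have : (((n : ℝ) - 2) * x j / (1 + ‖x‖ ^ 2)) ^ 2 * ‖h x‖ ^ 2 =
        ((n : ℝ) - 2) ^ 2 / (1 + ‖x‖ ^ 2) ^ 2 * ‖h x‖ ^ 2 * x j ^ 2 := by
        field_simp
      rw [this] at hsq
      have e2 : ((n : ℝ) - 2) * (1 / (1 + ‖x‖ ^ 2) - 2 * x j ^ 2 / (1 + ‖x‖ ^ 2) ^ 2) * ‖h x‖ ^ 2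
        = ((n : ℝ) - 2) / (1 + ‖x‖ ^ 2) * ‖h x‖ ^ 2
          - (2 * ((n : ℝ) - 2)) / (1 + ‖x‖ ^ 2) ^ 2 * ‖h x‖ ^ 2 * x j ^ 2 := by
        field_simp
      rw [e2, add_div]
      linarith
    have hcs : -(‖laplacian h x‖ * ‖h x‖) ≤ inner ℝ (laplacian h x) (h x) :=
      (abs_le.1 (abs_real_inner_le_norm _ _)).1
    have hprod : ‖laplacian h x‖ * ‖h x‖ =
        (‖laplacian h x‖ * (1 + ‖x‖ ^ 2)) * (‖h x‖ / (1 + ‖x‖ ^ 2)) := by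
      field_simp
    rw [hprod] at hcs
    rw [← div_pow] at hsum ⊢
    rw [← mul_pow]
    set a := ‖laplacian h x‖ * (1 + ‖x‖ ^ 2)
    set b := ‖h x‖ / (1 + ‖x‖ ^ 2)
    have h3 : c * b ^ 2 - a * b ≤ ∑ j, fderiv ℝ (g j) x (EuclideanSpace.single j 1) := by
      linarith
    have h4 := mul_le_mul_of_nonneg_left h3 (by positivity : 0 ≤ 2 * c)
    nlinarith [sq_nonneg (a - c * b)]
  have hint := MeasureTheory.integral_mono (hB.const_mul (c ^ 2)) (hA.add (hGi.const_mul (2 * c))) key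
  simp only [Pi.add_apply] at hint
  rw [MeasureTheory.integral_add hA (hGi.const_mul (2 * c)), MeasureTheory.integral_const_mul,
    MeasureTheory.integral_const_mul, hG0, mul_zero, add_zero] at hint
  have := Real.sqrt_le_sqrt hint
  rwa [Real.sqrt_mul (sq_nonneg c), Real.sqrt_sq hcpos.le] at this

end
end

section
/- Let n ≥ 1 and let k be a positive even integer; if n is even assume additionally k < n. Let F be a finite-dimensional real inner product space and let h : ℝⁿ → F be a smooth function with compact support. Set c = ∏_{j=1}^{k/2} (n + 2j − 2)·|n − 2j|. Then (∫_{ℝⁿ} ‖Δ^{k/2}h(x)‖² (1 + ‖x‖²)^k dx)^{1/2} ≥ c · (∫_{ℝⁿ} ‖h(x)‖² / (1 + ‖x‖²)^k dx)^{1/2}, where Δ^{k/2} denotes the (k/2)-fold iterate of the Laplacian Δ = Σ_{j=1}^n ∂²/∂xⱼ². -/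
noncomputable section

namespace WL

open MeasureTheory Filter Topology

abbrev E (n : ℕ) := EuclideanSpace ℝ (Fin n)

/-- smooth real functions -/
def S (n : ℕ) : Subalgebra ℝ (E n → ℝ) where
  carrier := {f | ContDiff ℝ (⊤ : ℕ∞) f}
  mul_mem' := fun ha hb => by
    rw [Set.mem_ofPred_eq] at *; exact ContDiff.mul ha hb
  add_mem' := fun ha hb => by
    rw [Set.mem_ofPred_eq] at *; exact ContDiff.add ha hb
  algebraMap_mem' := fun r => by
    rw [Set.mem_ofPred_eq]
    change ContDiff ℝ _ (fun _ => r)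
    exact contDiff_const

lemma mem_S {n : ℕ} {f : E n → ℝ} : f ∈ S n ↔ ContDiff ℝ (⊤ : ℕ∞) f := by
  change f ∈ {f | ContDiff ℝ (⊤ : ℕ∞) f} ↔ _
  rw [Set.mem_ofPred_eq]

variable {n : ℕ}

lemma S_smooth (f : S n) : ContDiff ℝ (⊤ : ℕ∞) (f : E n → ℝ) := mem_S.1 f.2
lemma S_diff (f : S n) : Differentiable ℝ (f : E n → ℝ) :=
  (S_smooth f).differentiable (by simp)
lemma S_cont (f : S n) : Continuous (f : E n → ℝ) := (S_smooth f).continuous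

lemma contDiff_pd {F : Type*} [NormedAddCommGroup F] [NormedSpace ℝ F] {f : E n → F}
    (hf : ContDiff ℝ (⊤ : ℕ∞) f) (v : E n) :
    ContDiff ℝ (⊤ : ℕ∞) (fun x => fderiv ℝ f x v) := by
  have : ContDiff ℝ (⊤ : ℕ∞) (fderiv ℝ f) := hf.fderiv_right (by simp)
  exact this.clm_apply contDiff_const

/-- partial derivative -/
def D (i : Fin n) : S n →ₗ[ℝ] S n where
  toFun f := ⟨fun x => fderiv ℝ (f : E n → ℝ) x (EuclideanSpace.single i 1),
    mem_S.2 (contDiff_pd (mem_S.1 f.2) _)⟩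
  map_add' f g := by
    ext x
    have := fderiv_add (S_diff f x) (S_diff g x)
    simp only [Subalgebra.coe_add, Pi.add_apply]
    rw [this]; rfl
  map_smul' r f := by
    ext x
    have := fderiv_const_smul (S_diff f x) r
    simp only [RingHom.id_apply, Subalgebra.coe_smul, Pi.smul_apply]
    rw [this]; rfl

lemma D_apply (i : Fin n) (f : S n) (x : E n) :
    (D i f : E n → ℝ) x = fderiv ℝ (f : E n → ℝ) x (EuclideanSpace.single i 1) := rfl

lemma D_mul (i : Fin n) (f g : S n) : D i (f * g) = D i f * g + f * D i g := by
  apply Subtype.ext; funext x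
  simp only [D_apply, Subalgebra.coe_mul, Subalgebra.coe_add, Pi.add_apply, Pi.mul_apply]
  rw [fderiv_mul (S_diff f x) (S_diff g x)]
  simp [mul_comm]; ring

lemma D_one (i : Fin n) : D i (1 : S n) = 0 := by
  have h := D_mul i 1 1
  simp only [mul_one, one_mul] at h
  simpa using h

lemma D_algebraMap (i : Fin n) (r : ℝ) : D i (algebraMap ℝ (S n) r) = 0 := by
  rw [Algebra.algebraMap_eq_smul_one, map_smul, D_one, smul_zero]

lemma D_comm (i j : Fin n) (f : S n) : D i (D j f) = D j (D i f) := by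
  apply Subtype.ext; funext x
  simp only [D_apply]
  have h1 : ∀ k : Fin n, (D k f : E n → ℝ) =
      fun y => fderiv ℝ (f : E n → ℝ) y (EuclideanSpace.single k 1) := fun k => rfl
  rw [h1, h1]
  have hd : DifferentiableAt ℝ (fderiv ℝ (f : E n → ℝ)) x := by
    have : ContDiff ℝ (⊤ : ℕ∞) (fderiv ℝ (f : E n → ℝ)) := (S_smooth f).fderiv_right (by simp)
    exact this.differentiable (by simp) x
  rw [fderiv_clm_apply hd (by fun_prop), fderiv_clm_apply hd (by fun_prop)]
  have hs : IsSymmSndFDerivAt ℝ (f : E n → ℝ) x := by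
    apply ContDiffAt.isSymmSndFDerivAt (n := (⊤ : ℕ∞)) (S_smooth f).contDiffAt
    simp only [minSmoothness_of_isRCLikeNormedField]
    exact WithTop.coe_le_coe.2 (le_top : (2 : ℕ∞) ≤ ⊤)
  simpa using hs _ _

/-- coordinates -/
def X (i : Fin n) : S n := ⟨fun x => x i, by
  rw [mem_S]; fun_prop⟩

lemma X_apply (i : Fin n) (x : E n) : ((X i : S n) : E n → ℝ) x = x i := rfl

lemma D_X (i j : Fin n) : D i (X j) = if i = j then 1 else 0 := by
  apply Subtype.ext; funext x
  rw [D_apply]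
  have : (X j : E n → ℝ) = (EuclideanSpace.proj j : E n →L[ℝ] ℝ) := rfl
  rw [this, ContinuousLinearMap.fderiv]
  by_cases h : i = j
  · subst h; simp
  · simp [h, Ne.symm h]

/-- powers of `1+|x|^2` -/
def rp (s : ℝ) : S n := ⟨fun x => (1 + ‖x‖ ^ 2) ^ s, by
  rw [mem_S]
  apply ContDiff.rpow_const_of_ne
  · exact contDiff_const.add (contDiff_norm_sq ℝ)
  · intro x; positivity⟩

lemma rp_apply (s : ℝ) (x : E n) : ((rp s : S n) : E n → ℝ) x = (1 + ‖x‖ ^ 2) ^ s := rfl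

lemma rp_mul (s s' : ℝ) : (rp s : S n) * rp s' = rp (s + s') := by
  apply Subtype.ext; funext x
  simp only [Subalgebra.coe_mul, Pi.mul_apply, rp_apply]
  rw [Real.rpow_add (by positivity)]

lemma rp_zero : (rp 0 : S n) = 1 := by
  apply Subtype.ext; funext x
  simp [rp_apply]

lemma rp_pow (s : ℝ) (m : ℕ) : (rp s : S n) ^ m = rp (m * s) := by
  induction m with
  | zero => simp [rp_zero]
  | succ m ih => rw [pow_succ, ih, rp_mul]; congr 1; push_cast; ring

lemma rp_one_eq : (rp 1 : S n) = 1 + ∑ i, X i * X i := by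
  apply Subtype.ext; funext x
  have : ((∑ i, X i * X i : S n) : E n → ℝ) x = ∑ i, x i * x i := by
    simp [X_apply]
  simp only [Subalgebra.coe_add, Pi.add_apply]
  rw [this]
  simp [rp_apply, EuclideanSpace.real_norm_sq_eq]
  simp [pow_two]

lemma D_rp (i : Fin n) (s : ℝ) : D i (rp s : S n) = (2 * s) • (X i * rp (s - 1)) := by
  apply Subtype.ext; funext x
  rw [D_apply]
  have h1 : HasFDerivAt (fun x : E n => 1 + ‖x‖ ^ 2) (2 • (innerSL ℝ x)) x :=
    ((hasStrictFDerivAt_norm_sq x).hasFDerivAt).const_add 1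
  have h2 := h1.rpow_const (p := s) (Or.inl (by positivity))
  have h3 : fderiv ℝ ((rp s : S n) : E n → ℝ) x = _ := h2.fderiv
  rw [h3]
  simp [rp_apply, X_apply, EuclideanSpace.inner_single_right]
  ring

/-- Laplacian -/
def Lap : S n →ₗ[ℝ] S n := ∑ i, D i ∘ₗ D i

lemma Lap_apply (f : S n) : Lap f = ∑ i, D i (D i f) := by simp [Lap]

/-- Euler operator -/
def Eu : S n →ₗ[ℝ] S n := ∑ i, LinearMap.mulLeft ℝ (X i) ∘ₗ D i

lemma Eu_apply (f : S n) : Eu f = ∑ i, X i * D i f := by simp [Eu]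

lemma Lap_mul (f g : S n) : Lap (f * g) = Lap f * g + 2 * (∑ i, D i f * D i g) + f * Lap g := by
  simp only [Lap_apply, Finset.sum_mul, Finset.mul_sum, ← Finset.sum_add_distrib]
  refine Finset.sum_congr rfl fun i _ => ?_
  simp only [D_mul, map_add]; ring

lemma Eu_mul (f g : S n) : Eu (f * g) = Eu f * g + f * Eu g := by
  simp only [Eu_apply, Finset.sum_mul, Finset.mul_sum, ← Finset.sum_add_distrib]
  refine Finset.sum_congr rfl fun i _ => ?_
  simp only [D_mul]; ring

lemma sum_X : ∑ i, (X i * X i : S n) = rp 1 - 1 := by rw [rp_one_eq]; ring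

lemma Eu_rp (s : ℝ) : Eu (rp s : S n) = (2 * s) • (rp s - rp (s - 1)) := by
  have : ∀ i : Fin n, X i * D i (rp s : S n) = (2 * s) • ((X i * X i) * rp (s - 1)) := by
    intro i; rw [D_rp, mul_smul_comm]; congr 1; ring
  simp only [Eu_apply, this]
  rw [← Finset.smul_sum, ← Finset.sum_mul, sum_X, sub_mul, rp_mul, one_mul]
  congr 3; ring

lemma Lap_rp (s : ℝ) : Lap (rp s : S n) =
    (2 * n * s) • rp (s - 1) + (4 * s * (s - 1)) • (rp (s - 1) - rp (s - 2)) := by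
  have : ∀ i : Fin n, D i (D i (rp s : S n)) =
      (2 * s) • rp (s - 1) + (4 * s * (s - 1)) • ((X i * X i) * rp (s - 2)) := by
    intro i
    rw [D_rp, map_smul, D_mul, D_X, D_rp]
    simp only [if_true, one_mul, smul_add, mul_smul_comm, smul_smul]
    congr 2
    · ring
    · rw [show s - 1 - 1 = s - 2 by ring]; ring
  simp only [Lap_apply, this]
  rw [Finset.sum_add_distrib, ← Finset.smul_sum, ← Finset.smul_sum, ← Finset.sum_mul, sum_X, sub_mul,
    rp_mul, one_mul]
  simp only [Finset.sum_const, Finset.card_univ, Fintype.card_fin]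
  rw [show (1 : ℝ) + (s - 2) = s - 1 by ring, ← Nat.cast_smul_eq_nsmul ℝ, smul_smul]
  congr 2; ring

lemma Lap_rp_mul (s : ℝ) (g : S n) : Lap (rp s * g) = rp s * Lap g + (4 * s) • (rp (s - 1) * Eu g)
    + ((2 * n * s) • rp (s - 1) + (4 * s * (s - 1)) • (rp (s - 1) - rp (s - 2))) * g := by
  rw [Lap_mul, Lap_rp]
  have : ∑ i, D i (rp s) * D i g = (2 * s) • (rp (s - 1) * Eu g) := by
    rw [Eu_apply, Finset.mul_sum, Finset.smul_sum]
    refine Finset.sum_congr rfl fun i _ => ?_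
    rw [D_rp, smul_mul_assoc]; congr 1; ring
  rw [this]
  have : (2 : S n) * (2 * s) • (rp (s - 1) * Eu g) = (4 * s) • (rp (s - 1) * Eu g) := by
    rw [show (2 : S n) = (2 : ℝ) • 1 by
      rw [two_smul, one_add_one_eq_two], smul_mul_assoc, one_mul, smul_smul]
    congr 1; ring
  rw [this]; ring

lemma Lap_Eu (f : S n) : Lap (Eu f) = Eu (Lap f) + (2 : ℝ) • Lap f := by
  have key : ∀ i j : Fin n, D i (D i (X j * D j f)) =
      X j * D j (D i (D i f)) + if i = j then (2 : ℝ) • D i (D i f) else 0 := by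
    intro i j
    simp only [D_mul, map_add, D_X]
    rw [D_comm i j f, D_comm i j (D i f)]
    by_cases h : i = j
    · subst h
      simp only [if_true, one_mul, D_one, zero_mul, two_smul]; ring
    · simp [h]
  simp only [Eu_apply, Lap_apply, map_sum, key, Finset.smul_sum]
  simp only [Finset.sum_add_distrib]
  congr 1
  · exact Finset.sum_comm
  · simp

end WL

namespace WL
open MeasureTheory Filter Topology
variable {n : ℕ}

lemma Lap_rp1_mul (w : S n) :
    Lap (rp 1 * w) = rp 1 * Lap w + (4 : ℝ) • Eu w + (2 * n : ℝ) • w := by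
  rw [Lap_rp_mul]; simp [rp_zero]

lemma Lap_iter_rp1 (m : ℕ) (g : S n) : Lap^[m + 1] (rp 1 * g) = rp 1 * Lap^[m + 1] g
    + (4 * (m + 1) : ℝ) • Eu (Lap^[m] g) + (4 * (m + 1) * m + 2 * n * (m + 1) : ℝ) • Lap^[m] g := by
  induction m with
  | zero => simp [Lap_rp1_mul]
  | succ m ih =>
    rw [Function.iterate_succ_apply', ih]
    simp only [map_add, map_smul, Lap_rp1_mul, Lap_Eu, ← Function.iterate_succ_apply' Lap]
    push_cast
    module

def Gp (f : S n) : ℕ → S n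
  | 0 => f
  | m + 1 => rp 2 * Lap (Gp f m) + (4 * m * (m + 1) : ℝ) • Gp f m

lemma Lap_iter_Gp (m : ℕ) (f : S n) :
    Lap^[m] (rp (m - 1) * f) = rp (-(m + 1)) * Gp f m := by
  induction m with
  | zero => simp [Gp]
  | succ m ih =>
    have e1 : (rp ((m + 1 : ℕ) - 1) : S n) * f = rp 1 * (rp (m - 1) * f) := by
      rw [← mul_assoc, rp_mul]; congr 2; push_cast; ring
    rw [e1, Lap_iter_rp1]
    set u := Lap^[m] (rp (m - 1) * f) with hu
    have hG : Gp f m = rp (m + 1) * u := by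
      rw [ih, ← mul_assoc, rp_mul, add_neg_cancel, rp_zero, one_mul]
    rw [Gp, hG, Function.iterate_succ_apply', ← hu, Lap_rp_mul]
    have a1 : (rp (-((m + 1 : ℕ) + 1)) : S n) = rp (-m - 2) := by congr 1; push_cast; ring
    have b2 : (rp 2 : S n) = rp 1 * rp 1 := by rw [rp_mul]; norm_num
    have b3 : (rp (m + 1) : S n) = rp 1 * rp 1 * rp (m - 1) := by
      rw [rp_mul, rp_mul]; congr 1; ring
    have b4 : (rp (m + 1 - 1) : S n) = rp 1 * rp (m - 1) := by
      rw [rp_mul]; congr 1; ring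
    have b5 : (rp (m + 1 - 2) : S n) = rp (m - 1) := by congr 1; ring
    have b6 : (rp (-m - 2) * rp 1 * rp 1 * rp 1 * rp (m - 1) : S n) = 1 := by
      rw [rp_mul, rp_mul, rp_mul, rp_mul, ← rp_zero]; congr 1; ring
    rw [a1, b2, b3, b4, b5]
    simp only [Algebra.smul_def]
    simp only [map_mul, map_add, map_sub, map_one, map_natCast, map_ofNat]
    generalize (rp (-m - 2) : S n) = p at *
    generalize (rp 1 : S n) = r at *
    generalize (rp (m - 1) : S n) = q at *
    linear_combination (-(r * Lap u) - 4 * (m + 1) * Eu u - (4 * (m + 1) * m + 2 * n * (m + 1)) * u) * b6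

/-- the sphere Laplacian -/
def Ls : S n →ₗ[ℝ] S n where
  toFun v := rp 2 * Lap v - (2 * (n - 2) : ℝ) • (rp 1 * Eu v)
  map_add' a b := by
    simp only [map_add, mul_add, smul_add]; abel
  map_smul' c a := by
    simp only [map_smul, mul_smul_comm, smul_sub, RingHom.id_apply]
    rw [smul_comm]

lemma Ls_apply (v : S n) : Ls v = rp 2 * Lap v - (2 * (n - 2) : ℝ) • (rp 1 * Eu v) := rfl

def T (v : S n) : ℕ → S n
  | 0 => v
  | m + 1 => Ls (T v m) + (4 * m * (m + 1) - n * (n - 2) : ℝ) • T v m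

lemma G_conj (v : S n) : rp 2 * Lap (rp (1 - n / 2) * v)
    = rp (1 - n / 2) * (Ls v - (n * (n - 2) : ℝ) • v) := by
  rw [Lap_rp_mul, Ls_apply]
  have b2 : (rp 2 : S n) = rp 1 * rp 1 := by rw [rp_mul]; norm_num
  have b3 : (rp (1 - n / 2) : S n) = rp 1 * rp 1 * rp (1 - n / 2 - 2) := by
    rw [rp_mul, rp_mul]; congr 1; ring
  have b4 : (rp (1 - n / 2 - 1) : S n) = rp 1 * rp (1 - n / 2 - 2) := by
    rw [rp_mul]; congr 1; ring
  rw [b2, b3, b4]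
  have hh : algebraMap ℝ (S n) (1 - n / 2) = 1 - n * algebraMap ℝ (S n) (1 / 2) := by
    rw [div_eq_mul_one_div]; simp only [map_mul, map_sub, map_one, map_natCast]
  have h2 : 2 * algebraMap ℝ (S n) (1 / 2) = 1 := by
    rw [← map_ofNat (algebraMap ℝ (S n)) 2, ← map_mul]; norm_num
  simp only [Algebra.smul_def]
  simp only [map_mul, map_sub (algebraMap ℝ (S n)) _ (1 : ℝ), hh, map_sub, map_natCast, map_ofNat, map_one]
  generalize algebraMap ℝ (S n) (1 / 2) = a at *
  generalize (rp (1 - n / 2 - 2) : S n) = p at *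
  generalize (rp 1 : S n) = r at *
  linear_combination (-2 * n * r * r * r * p * Eu v - n * n * r ^ 3 * p * v
    + (2 * n * a + n - 2) * n * r ^ 2 * (r - 1) * p * v) * h2

lemma Gp_conj (m : ℕ) (v : S n) : Gp (rp (1 - n / 2) * v) m = rp (1 - n / 2) * T v m := by
  induction m with
  | zero => rfl
  | succ m ih =>
    rw [Gp, ih, G_conj, T]
    simp only [mul_add, mul_sub, sub_smul, mul_smul_comm]
    module

lemma factorization (m : ℕ) (v : S n) :
    Lap^[m] (rp (m - n / 2) * v) = rp (-m - n / 2) * T v m := by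
  have := Lap_iter_Gp m (rp (1 - n / 2) * v)
  rw [Gp_conj, ← mul_assoc, ← mul_assoc, rp_mul, rp_mul] at this
  convert this using 3
  · congr 1; ring
  · congr 1; ring

end WL

namespace WL
open MeasureTheory Filter Topology
variable {n : ℕ}

def t : S n := rp (-1)
def s (i : Fin n) : S n := X i * rp (-1)

lemma rp1_t : (rp 1 : S n) * t = 1 := by rw [t, rp_mul, ← rp_zero]; congr 1; ring
lemma rp2_eq : (rp 2 : S n) = rp 1 ^ 2 := by rw [rp_pow]; norm_num
lemma rpn_eq (m : ℕ) : (rp (-m) : S n) = t ^ m := by rw [t, rp_pow]; norm_num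

lemma D_t (i : Fin n) : D i (t : S n) = (-2 : ℝ) • (X i * t ^ 2) := by
  rw [t, D_rp, ← t, ← rpn_eq]; norm_num

lemma D_s (i j : Fin n) : D i (s j : S n) = (if i = j then t else 0) + (-2 : ℝ) • (X i * X j * t ^ 2) := by
  rw [s, ← t, D_mul, D_t, D_X, mul_smul_comm, ite_mul, one_mul, zero_mul]
  congr 2; ring

/-- carre du champ -/
def Gam (f g : S n) : S n := rp 2 * ∑ i, D i f * D i g

lemma Gam_add_left (f f' g : S n) : Gam (f + f') g = Gam f g + Gam f' g := by
  simp only [Gam, map_add, add_mul, Finset.sum_add_distrib, mul_add]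
lemma Gam_smul_left (c : ℝ) (f g : S n) : Gam (c • f) g = c • Gam f g := by
  simp only [Gam, map_smul, smul_mul_assoc, ← Finset.smul_sum, mul_smul_comm]
lemma Gam_comm (f g : S n) : Gam f g = Gam g f := by
  simp only [Gam]; congr 1; exact Finset.sum_congr rfl fun i _ => mul_comm _ _
lemma Gam_add_right (f g g' : S n) : Gam f (g + g') = Gam f g + Gam f g' := by
  rw [Gam_comm, Gam_add_left, Gam_comm g, Gam_comm g']
lemma Gam_smul_right (c : ℝ) (f g : S n) : Gam f (c • g) = c • Gam f g := by
  rw [Gam_comm, Gam_smul_left, Gam_comm g]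
lemma Gam_mul_right (f g g' : S n) : Gam f (g * g') = g' * Gam f g + g * Gam f g' := by
  simp only [Gam, D_mul, Finset.mul_sum, ← Finset.sum_add_distrib]
  exact Finset.sum_congr rfl fun i _ => by ring
lemma Gam_one_left (g : S n) : Gam 1 g = 0 := by
  simp [Gam, D_one]
lemma Gam_one_right (g : S n) : Gam g 1 = 0 := by
  rw [Gam_comm, Gam_one_left]

lemma Ls_mul (f g : S n) : Ls (f * g) = f * Ls g + g * Ls f + 2 * Gam f g := by
  simp only [Ls_apply, Lap_mul, Eu_mul, Gam, Algebra.smul_def]; ring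

lemma smul_two (c : ℝ) (f : S n) : c • f = algebraMap ℝ (S n) c * f := Algebra.smul_def _ _

lemma ax1 {R : Type*} [CommRing R] (r t : R) (h : r * t = 1) :
    r ^ 2 * (4 * t ^ 4 * (r - 1)) = 4 * t - 4 * t * t := by
  have h2 : r ^ 2 * t ^ 2 = 1 := by rw [← mul_pow, h, one_pow]
  have h3 : r ^ 3 * t ^ 3 = 1 := by rw [← mul_pow, h, one_pow]
  linear_combination (4 * t) * h3 - 4 * t ^ 2 * h2
lemma ax2 {R : Type*} [CommRing R] (r t x : R) (h : r * t = 1) :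
    r ^ 2 * (-2 * x * t ^ 3 + 4 * t ^ 4 * x * (r - 1)) = 2 * (x * t) - 4 * t * (x * t) := by
  have h2 : r ^ 2 * t ^ 2 = 1 := by rw [← mul_pow, h, one_pow]
  have h3 : r ^ 3 * t ^ 3 = 1 := by rw [← mul_pow, h, one_pow]
  linear_combination (4 * t * x) * h3 - 4 * t ^ 2 * x * h2 - 2 * x * t * h2
lemma ax3 {R : Type*} [CommRing R] (r t x y d : R) (h : r * t = 1) :
    r ^ 2 * (d * t ^ 2 - 2 * x * y * t ^ 3 + - 2 * x * y * t ^ 3 + 4 * t ^ 4 * x * y * (r - 1))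
      = d - 4 * (x * t) * (y * t) := by
  have h2 : r ^ 2 * t ^ 2 = 1 := by rw [← mul_pow, h, one_pow]
  have h3 : r ^ 3 * t ^ 3 = 1 := by rw [← mul_pow, h, one_pow]
  linear_combination (4 * t * x * y) * h3 - 4 * t ^ 2 * x * y * h2 - 4 * x * y * t * h2 + d * h2

lemma s_eq (j : Fin n) : (s j : S n) = X j * t := rfl

lemma Gam_t_t : Gam (t : S n) t = 4 * t - 4 * t * t := by
  have : ∀ i : Fin n, D i t * D i t = 4 * t ^ 4 * (X i * X i) := by
    intro i; rw [D_t]; simp only [smul_two, map_neg, map_ofNat]; ring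
  simp only [Gam, this]
  rw [← Finset.mul_sum, sum_X, rp2_eq]
  exact ax1 _ _ rp1_t

lemma Gam_t_s (j : Fin n) : Gam (t : S n) (s j) = 2 * s j - 4 * t * s j := by
  have : ∀ i : Fin n, D i t * D i (s j) =
      (if i = j then -2 * X j * t ^ 3 else 0) + 4 * t ^ 4 * X j * (X i * X i) := by
    intro i; rw [D_t, D_s]; simp only [smul_two, map_neg, map_ofNat]
    split_ifs with h
    · subst h; ring
    · ring
  simp only [Gam, this]
  rw [Finset.sum_add_distrib, ← Finset.mul_sum, sum_X, rp2_eq]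
  simp only [Finset.sum_ite_eq', Finset.mem_univ, if_true, s_eq]
  exact ax2 _ _ _ rp1_t

lemma Gam_s_s (j k : Fin n) : Gam (s j : S n) (s k) = (if j = k then 1 else 0) - 4 * s j * s k := by
  have : ∀ i : Fin n, D i (s j) * D i (s k) =
      (if i = j then (if j = k then 1 else 0) * t ^ 2 - 2 * X j * X k * t ^ 3 else 0)
      + (if i = k then - 2 * X j * X k * t ^ 3 else 0) + 4 * t ^ 4 * X j * X k * (X i * X i) := by
    intro i; rw [D_s, D_s]; simp only [smul_two, map_neg, map_ofNat]
    by_cases h : i = j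
    · subst h
      by_cases h' : i = k
      · subst h'; simp only [if_true]; ring
      · simp only [if_true, if_neg h']; ring
    · by_cases h' : i = k
      · subst h'; simp only [if_true, if_neg h]; ring
      · simp only [if_neg h, if_neg h']; ring
  simp only [Gam, this]
  rw [Finset.sum_add_distrib, Finset.sum_add_distrib, ← Finset.mul_sum, sum_X, rp2_eq]
  simp only [Finset.sum_ite_eq', Finset.mem_univ, if_true, s_eq]
  exact ax3 _ _ _ _ _ rp1_t

lemma Lap_X (j : Fin n) : Lap (X j : S n) = 0 := by
  simp only [Lap_apply, D_X]
  refine Finset.sum_eq_zero fun i _ => ?_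
  split_ifs
  · exact D_one i
  · simp

lemma Eu_X (j : Fin n) : Eu (X j : S n) = X j := by
  simp only [Eu_apply, D_X]; simp

lemma Eu_t : Eu (t : S n) = -2 * (t - t ^ 2) := by
  rw [t, Eu_rp, show (-1 - 1 : ℝ) = -(2 : ℕ) by norm_num, rpn_eq, ← t]
  simp only [smul_two, map_neg, map_ofNat, map_mul, map_one]; ring

lemma ax4 {R : Type*} [CommRing R] (r t N : R) (h : r * t = 1) :
    r ^ 2 * (-(2 * N) * t ^ 2 + 8 * (t ^ 2 - t ^ 3)) - 2 * (N - 2) * (r * (-2 * (t - t ^ 2)))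
      + 4 * N * t = 2 * N := by
  have h2 : r ^ 2 * t ^ 2 = 1 := by rw [← mul_pow, h, one_pow]
  linear_combination (-(2 * N) + 8 - 8 * t) * h2 + 4 * (N - 2) * h - 4 * (N - 2) * t * h
lemma ax5 {R : Type*} [CommRing R] (r t N x : R) (h : r * t = 1) :
    r ^ 2 * (-4 * (t ^ 2 * x) + (-(2 * N) * t ^ 2 + 8 * (t ^ 2 - t ^ 3)) * x)
      - 2 * (N - 2) * (r * (-2 * (t - t ^ 2) * x + t * x)) + 4 * N * (t * x) = 0 := by
  have h2 : r ^ 2 * t ^ 2 = 1 := by rw [← mul_pow, h, one_pow]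
  linear_combination (-4 * x + (-(2 * N) + 8 - 8 * t) * x) * h2 + (4 * (N - 2) * (1 - t) - 2 * (N - 2)) * x * h

lemma Ls_t : Ls (t : S n) + (4 * n : ℝ) • t = algebraMap ℝ (S n) (2 * n) := by
  have hL := Lap_rp (n := n) (-1)
  rw [show (-1 - 1 : ℝ) = -(2 : ℕ) by norm_num, show (-1 - 2 : ℝ) = -(3 : ℕ) by norm_num,
    rpn_eq, rpn_eq, show (4 * -1 * -((2:ℕ):ℝ)) = 8 by norm_num,
    show (2 * (n:ℝ) * -1) = -(2 * n) by ring] at hL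
  rw [Ls_apply, Eu_t]
  conv_lhs => enter [1, 1, 2]; rw [t, hL]
  rw [rp2_eq]
  simp only [smul_two, map_neg, map_ofNat, map_mul, map_one, map_sub, map_natCast, map_add]
  exact ax4 _ _ _ rp1_t

lemma Ls_s (j : Fin n) : Ls (s j : S n) + (4 * n : ℝ) • s j = 0 := by
  have e : (s j : S n) = t * X j := by rw [s_eq, mul_comm]
  have hE : Eu (s j : S n) = -2 * (t - t ^ 2) * X j + t * X j := by
    rw [e, Eu_mul, Eu_t, Eu_X]
  rw [Ls_apply, hE]
  have hL := Lap_rp_mul (n := n) (-1) (X j)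
  rw [show (-1 - 1 : ℝ) = -(2 : ℕ) by norm_num, show (-1 - 2 : ℝ) = -(3 : ℕ) by norm_num,
    rpn_eq, rpn_eq, show (4 * -1 * -((2:ℕ):ℝ)) = 8 by norm_num,
    show (2 * (n:ℝ) * -1) = -(2 * n) by ring, Eu_X, Lap_X, mul_zero, zero_add,
    show (4 * -1 : ℝ) = -4 by norm_num] at hL
  have hL' : Lap (s j : S n) = _ := (congrArg Lap e).trans hL
  rw [hL', rp2_eq, e]
  simp only [smul_two, map_neg, map_ofNat, map_mul, map_one, map_sub, map_natCast, map_add]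
  exact ax5 _ _ _ _ rp1_t

end WL

namespace WL
open MeasureTheory Filter Topology
variable {n : ℕ}

def V1 (n : ℕ) : Submodule ℝ (S n) := Submodule.span ℝ (insert 1 (insert t (Set.range s)))

lemma one_mem_V1 : (1 : S n) ∈ V1 n := Submodule.subset_span (by simp)
lemma t_mem_V1 : (t : S n) ∈ V1 n := Submodule.subset_span (by simp)
lemma s_mem_V1 (j : Fin n) : (s j : S n) ∈ V1 n := Submodule.subset_span (by simp)

lemma Gam_gen (z y : S n) (hz : z ∈ insert 1 (insert t (Set.range (s (n := n)))))
    (hy : y ∈ insert 1 (insert t (Set.range (s (n := n))))) :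
    Gam z y + (4 : ℝ) • (z * y) ∈ V1 n := by
  have ht := t_mem_V1 (n := n)
  have ho := one_mem_V1 (n := n)
  have hs := s_mem_V1 (n := n)
  have e4 : ∀ a : S n, 4 * a = (4 : ℝ) • a := fun a => by rw [smul_two, map_ofNat]
  have e2 : ∀ a : S n, 2 * a = (2 : ℝ) • a := fun a => by rw [smul_two, map_ofNat]
  simp only [Set.mem_insert_iff, Set.mem_range] at hz hy
  rcases hz with rfl | rfl | ⟨j, rfl⟩ <;> rcases hy with rfl | rfl | ⟨k, rfl⟩
  · rw [Gam_one_left, zero_add, mul_one]; exact Submodule.smul_mem _ _ ho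
  · rw [Gam_one_left, zero_add, one_mul]; exact Submodule.smul_mem _ _ ht
  · rw [Gam_one_left, zero_add, one_mul]; exact Submodule.smul_mem _ _ (hs _)
  · rw [Gam_one_right, zero_add, mul_one]; exact Submodule.smul_mem _ _ ht
  · rw [Gam_t_t, mul_assoc, e4, e4, sub_add_cancel]; exact Submodule.smul_mem _ _ ht
  · rw [Gam_t_s, mul_assoc, e4, e2, sub_add_cancel]; exact Submodule.smul_mem _ _ (hs _)
  · rw [Gam_one_right, zero_add, mul_one]; exact Submodule.smul_mem _ _ (hs _)
  · rw [Gam_comm, Gam_t_s, mul_assoc, e4, e2, mul_comm (s j), sub_add_cancel]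
    exact Submodule.smul_mem _ _ (hs _)
  · rw [Gam_s_s, mul_assoc, e4, sub_add_cancel]
    split_ifs
    · exact ho
    · exact Submodule.zero_mem _

lemma Gam_V1 (z y : S n) (hz : z ∈ V1 n) (hy : y ∈ V1 n) :
    Gam z y + (4 : ℝ) • (z * y) ∈ V1 n := by
  induction hz, hy using Submodule.span_induction₂ with
  | mem_mem z y hz hy => exact Gam_gen z y hz hy
  | zero_left y hy =>
    have : Gam (0 : S n) y = 0 := by simpa using Gam_smul_left (0 : ℝ) 0 y
    simp [this]
  | zero_right y hy =>
    have : Gam y (0 : S n) = 0 := by simpa using Gam_smul_right (0 : ℝ) y 0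
    simp [this]
  | add_left x y z hx hy hz h1 h2 =>
    convert Submodule.add_mem _ h1 h2 using 1
    rw [Gam_add_left, add_mul, smul_add]; abel
  | add_right x y z hx hy hz h1 h2 =>
    convert Submodule.add_mem _ h1 h2 using 1
    rw [Gam_add_right, mul_add, smul_add]; abel
  | smul_left r x y hx hy h =>
    convert Submodule.smul_mem _ r h using 1
    rw [Gam_smul_left, smul_add, smul_mul_assoc, smul_comm]
  | smul_right r x y hx hy h =>
    convert Submodule.smul_mem _ r h using 1
    rw [Gam_smul_right, smul_add, mul_smul_comm, smul_comm]

lemma Ls_one : Ls (1 : S n) = 0 := by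
  have h1 : Lap (1 : S n) = 0 := by simp [Lap_apply, D_one]
  have h2 : Eu (1 : S n) = 0 := by simp [Eu_apply, D_one]
  simp [Ls_apply, h1, h2]

lemma Ls_V1 (y : S n) (hy : y ∈ V1 n) :
    Ls y + (4 * n : ℝ) • y ∈ (1 : Submodule ℝ (S n)) := by
  induction hy using Submodule.span_induction with
  | mem y hy =>
    simp only [Set.mem_insert_iff, Set.mem_range] at hy
    rcases hy with rfl | rfl | ⟨k, rfl⟩
    · rw [Ls_one, zero_add]; exact Submodule.smul_mem _ _ (Submodule.mem_one.2 ⟨1, map_one _⟩)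
    · rw [Ls_t]; exact Submodule.mem_one.2 ⟨_, rfl⟩
    · rw [Ls_s]; exact Submodule.zero_mem _
  | zero => simp
  | add x y hx hy h1 h2 =>
    convert Submodule.add_mem _ h1 h2 using 1
    rw [map_add, smul_add]; abel
  | smul r x hx h =>
    convert Submodule.smul_mem _ r h using 1
    rw [map_smul, smul_add, smul_comm]

lemma Gam_pow (d : ℕ) (z : S n) (hz : z ∈ V1 n) : ∀ Q ∈ V1 n ^ d,
    Gam z Q + (4 * d : ℝ) • (z * Q) ∈ V1 n ^ d := by
  induction d with
  | zero =>
    intro Q hQ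
    rw [pow_zero] at hQ ⊢
    obtain ⟨c, rfl⟩ := Submodule.mem_one.1 hQ
    rw [Algebra.algebraMap_eq_smul_one, Gam_smul_right, Gam_one_right]; simp
  | succ d ih =>
    intro Q hQ
    rw [pow_succ'] at hQ ⊢
    induction hQ using Submodule.mul_induction_on' with
    | mem_mul_mem y hy Q hQ =>
      have h1 := Submodule.mul_mem_mul hy (ih Q hQ)
      have h2 := Submodule.mul_mem_mul (Gam_V1 z y hz hy) hQ
      convert Submodule.add_mem _ h1 h2 using 1
      rw [Gam_mul_right]
      simp only [Algebra.smul_def, map_mul, map_natCast, map_ofNat]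
      push_cast; ring
    | add x hx y hy h1 h2 =>
      convert Submodule.add_mem _ h1 h2 using 1
      rw [Gam_add_right, mul_add, smul_add]; abel

def lam (n l : ℕ) : ℝ := 4 * l * (n + l - 1)

lemma Ls_pow_zero (Q : S n) (hQ : Q ∈ V1 n ^ 0) : Ls Q = 0 := by
  rw [pow_zero] at hQ
  obtain ⟨c, rfl⟩ := Submodule.mem_one.1 hQ
  rw [Algebra.algebraMap_eq_smul_one, map_smul, Ls_one, smul_zero]

lemma Ls_pow (d : ℕ) : ∀ Q ∈ V1 n ^ (d + 1), Ls Q + lam n (d + 1) • Q ∈ V1 n ^ d := by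
  induction d with
  | zero =>
    intro Q hQ
    rw [zero_add, pow_one] at hQ
    rw [pow_zero]
    have := Ls_V1 Q hQ
    convert this using 3
    simp [lam]
  | succ d ih =>
    intro Q hQ
    rw [pow_succ'] at hQ
    induction hQ using Submodule.mul_induction_on' with
    | mem_mul_mem y hy Q hQ =>
      have h1 : y * (Ls Q + lam n (d + 1) • Q) ∈ V1 n ^ (d + 1) := by
        rw [pow_succ']; exact Submodule.mul_mem_mul hy (ih Q hQ)
      have h2 : (Ls y + (4 * n : ℝ) • y) * Q ∈ V1 n ^ (d + 1) := by
        have := Submodule.mul_mem_mul (Ls_V1 y hy) hQ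
        rwa [one_mul] at this
      have h3 := Submodule.smul_mem _ (2 : ℝ) (Gam_pow (d + 1) y hy Q hQ)
      convert Submodule.add_mem _ (Submodule.add_mem _ h1 h2) h3 using 1
      rw [Ls_mul]
      simp only [lam, Algebra.smul_def, map_mul, map_natCast, map_ofNat, map_sub, map_add, map_one]
      push_cast; ring
    | add x hx y hy h1 h2 =>
      convert Submodule.add_mem _ h1 h2 using 1
      rw [map_add, smul_add]; abel

lemma V1_pow_le (d : ℕ) : V1 n ^ d ≤ V1 n ^ (d + 1) := by
  intro Q hQ
  rw [pow_succ', ← one_mul Q]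
  exact Submodule.mul_mem_mul one_mem_V1 hQ

lemma lam_lt (hn : 1 ≤ n) {l d : ℕ} (h : l < d) : lam n l < lam n d := by
  have h1 : (1 : ℝ) ≤ n := by exact_mod_cast hn
  have h2 : (l : ℝ) + 1 ≤ d := by exact_mod_cast h
  have h3 : (0 : ℝ) ≤ l := Nat.cast_nonneg _
  unfold lam; nlinarith

lemma decomp (hn : 1 ≤ n) (d : ℕ) : ∀ Q ∈ V1 n ^ d, ∃ φ : ℕ → S n, (∀ l, φ l ∈ V1 n ^ d) ∧
    (∀ l, Ls (φ l) = (-lam n l) • φ l) ∧ Q = ∑ l ∈ Finset.range (d + 1), φ l := by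
  induction d with
  | zero =>
    intro Q hQ
    refine ⟨fun l => if l = 0 then Q else 0, fun l => ?_, fun l => ?_, ?_⟩
    · dsimp only; split_ifs
      · exact hQ
      · exact Submodule.zero_mem _
    · dsimp only; split_ifs with h
      · rw [Ls_pow_zero Q hQ, h]; simp [lam]
      · simp
    · simp
  | succ d ih =>
    intro Q hQ
    obtain ⟨ψ, h1, h2, h3⟩ := ih _ (Ls_pow d Q hQ)
    set a : ℕ → ℝ := fun l => (lam n (d + 1) - lam n l)⁻¹ with ha
    set R : S n := Q - ∑ l ∈ Finset.range (d + 1), a l • ψ l with hR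
    have hRm : R ∈ V1 n ^ (d + 1) := by
      refine Submodule.sub_mem _ hQ (Submodule.sum_mem _ fun l _ => Submodule.smul_mem _ _ ?_)
      exact V1_pow_le d (h1 l)
    have hRe : Ls R = (-lam n (d + 1)) • R := by
      rw [neg_smul, eq_neg_iff_add_eq_zero, hR, map_sub, smul_sub, sub_add_sub_comm, h3, map_sum,
        Finset.smul_sum, ← Finset.sum_add_distrib, ← Finset.sum_sub_distrib]
      refine Finset.sum_eq_zero fun l hl => ?_
      have := lam_lt hn (Finset.mem_range.1 hl)
      have hne : lam n (d + 1) - lam n l ≠ 0 := by linarith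
      have : a l * (lam n (d + 1) - lam n l) = 1 := inv_mul_cancel₀ hne
      rw [map_smul, h2, smul_smul, smul_smul, ← add_smul]
      rw [show a l * -lam n l + lam n (d + 1) * a l = 1 by linarith, one_smul, sub_self]
    refine ⟨fun l => if l < d + 1 then a l • ψ l else if l = d + 1 then R else 0,
      fun l => ?_, fun l => ?_, ?_⟩
    · dsimp only; split_ifs with h h'
      · exact Submodule.smul_mem _ _ (V1_pow_le d (h1 l))
      · exact hRm
      · exact Submodule.zero_mem _
    · dsimp only; split_ifs with h h'
      · rw [map_smul, h2, smul_comm]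
      · rw [hRe, h']
      · simp
    · rw [Finset.sum_range_succ]
      rw [Finset.sum_congr rfl (g := fun l => a l • ψ l)
        (fun l hl => by simp [Finset.mem_range.1 hl])]
      simp [hR]

def Valg (n : ℕ) : Subalgebra ℝ (S n) := Algebra.adjoin ℝ (insert t (Set.range s))

lemma V1_le_Valg : V1 n ≤ Subalgebra.toSubmodule (Valg n) := by
  refine Submodule.span_le.2 ?_
  intro x hx
  rcases hx with rfl | hx
  · exact (Valg n).one_mem
  · exact Algebra.subset_adjoin hx

lemma V1_pow_le_Valg (d : ℕ) : ∀ Q ∈ V1 n ^ d, Q ∈ Valg n := by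
  induction d with
  | zero =>
    intro Q hQ
    rw [pow_zero] at hQ
    obtain ⟨c, rfl⟩ := Submodule.mem_one.1 hQ
    exact (Valg n).algebraMap_mem c
  | succ d ih =>
    intro Q hQ
    rw [pow_succ'] at hQ
    induction hQ using Submodule.mul_induction_on' with
    | mem_mul_mem y hy Q hQ => exact (Valg n).mul_mem (V1_le_Valg hy) (ih Q hQ)
    | add x hx y hy h1 h2 => exact (Valg n).add_mem h1 h2

lemma V1_pow_mono {d e : ℕ} (h : d ≤ e) : V1 n ^ d ≤ V1 n ^ e :=
  monotone_nat_of_le_succ (f := fun d => V1 n ^ d) V1_pow_le h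

lemma Valg_le (Q : S n) (hQ : Q ∈ Valg n) : ∃ d, Q ∈ V1 n ^ d := by
  induction hQ using Algebra.adjoin_induction with
  | mem x hx =>
    refine ⟨1, ?_⟩
    rw [pow_one]; exact Submodule.subset_span (Set.mem_insert_of_mem _ hx)
  | algebraMap r => exact ⟨0, by rw [pow_zero]; exact Submodule.mem_one.2 ⟨r, rfl⟩⟩
  | add x y hx hy h1 h2 =>
    obtain ⟨d, h1⟩ := h1
    obtain ⟨e, h2⟩ := h2
    exact ⟨max d e, Submodule.add_mem _ (V1_pow_mono (le_max_left _ _) h1)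
      (V1_pow_mono (le_max_right _ _) h2)⟩
  | mul x y hx hy h1 h2 =>
    obtain ⟨d, h1⟩ := h1
    obtain ⟨e, h2⟩ := h2
    exact ⟨d + e, by rw [pow_add]; exact Submodule.mul_mem_mul h1 h2⟩

end WL

namespace WL
open MeasureTheory Filter Topology
variable {n : ℕ}

def CS (f : S n) : Prop := HasCompactSupport (f : E n → ℝ)
def Int (f : S n) : Prop := Integrable (f : E n → ℝ)
/-- integral -/
def I (f : S n) : ℝ := ∫ x, (f : E n → ℝ) x

lemma CS.int {f : S n} (h : CS f) : Int f := (S_cont f).integrable_of_hasCompactSupport h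
lemma CS.mul_right {f : S n} (h : CS f) (g : S n) : CS (f * g) := HasCompactSupport.mul_right h
lemma CS.mul_left {f : S n} (h : CS f) (g : S n) : CS (g * f) := HasCompactSupport.mul_left h
lemma CS.add {f g : S n} (h : CS f) (h' : CS g) : CS (f + g) := HasCompactSupport.add h h'
lemma CS.smul {f : S n} (c : ℝ) (h : CS f) : CS (c • f) := by
  rw [smul_two]; exact h.mul_left _
lemma CS.sub {f g : S n} (h : CS f) (h' : CS g) : CS (f - g) := by
  rw [sub_eq_add_neg, ← neg_one_smul ℝ g]; exact h.add (h'.smul _)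
lemma CS.D {f : S n} (h : CS f) (i : Fin n) : CS (D i f) := HasCompactSupport.fderiv_apply ℝ h _
lemma CS.sum {ι : Type*} (A : Finset ι) {f : ι → S n} (h : ∀ i, CS (f i)) : CS (∑ i ∈ A, f i) := by
  classical
  induction A using Finset.induction_on with
  | empty => simpa [CS] using HasCompactSupport.zero
  | insert a A ha ih => rw [Finset.sum_insert ha]; exact (h a).add ih
lemma CS.Ls {f : S n} (h : CS f) : CS (Ls f) := by
  rw [Ls_apply, Lap_apply, Eu_apply]
  exact ((CS.sum _ fun i => (h.D i).D i).mul_left _).sub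
    (((CS.sum _ fun i => (h.D i).mul_left _).mul_left _).smul _)
lemma CS.T {f : S n} (h : CS f) (m : ℕ) : CS (T f m) := by
  induction m with
  | zero => exact h
  | succ m ih => exact ih.Ls.add (ih.smul _)

lemma I_add {f g : S n} (hf : Int f) (hg : Int g) : I (f + g) = I f + I g :=
  integral_add hf hg
lemma I_sub {f g : S n} (hf : Int f) (hg : Int g) : I (f - g) = I f - I g :=
  integral_sub hf hg
lemma I_smul (c : ℝ) (f : S n) : I (c • f) = c * I f := integral_const_mul c _
lemma Int.add {f g : S n} (hf : Int f) (hg : Int g) : Int (f + g) := Integrable.add hf hg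
lemma Int.sub {f g : S n} (hf : Int f) (hg : Int g) : Int (f - g) := Integrable.sub hf hg
lemma Int.smul (c : ℝ) {f : S n} (hf : Int f) : Int (c • f) := Integrable.smul c hf
lemma Int.sum {ι : Type*} (A : Finset ι) {f : ι → S n} (h : ∀ i ∈ A, Int (f i)) : Int (∑ i ∈ A, f i) := by
  classical
  induction A using Finset.induction_on with
  | empty => simp [Int]
  | insert a A ha ih =>
    rw [Finset.sum_insert ha]
    exact (h a (by simp)).add (ih fun i hi => h i (by simp [hi]))
lemma I_sum {ι : Type*} (A : Finset ι) {f : ι → S n} (h : ∀ i ∈ A, Int (f i)) :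
    I (∑ i ∈ A, f i) = ∑ i ∈ A, I (f i) := by
  classical
  induction A using Finset.induction_on with
  | empty => simp [I]
  | insert a A ha ih =>
    rw [Finset.sum_insert ha, Finset.sum_insert ha, I_add (h a (by simp))
      (Int.sum _ fun i hi => h i (by simp [hi])), ih fun i hi => h i (by simp [hi])]

lemma I_D (i : Fin n) (W : S n) (h1 : Int W) (h2 : Int (D i W)) : I (D i W) = 0 := by
  have h2' : Integrable (fun x => fderiv ℝ (W : E n → ℝ) x (EuclideanSpace.single i 1)) := h2
  have h1' : Integrable (fun x => (W : E n → ℝ) x) := h1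
  have := integral_mul_fderiv_eq_neg_fderiv_mul_of_integrable (μ := (volume : Measure (E n)))
    (v := EuclideanSpace.single i (1:ℝ))
    (f := fun _ : E n => (1 : ℝ)) (g := (W : E n → ℝ)) (by simp) (by simpa using h2')
    (by simpa using h1') (by intro x _; fun_prop) (fun x _ => S_diff W x)
  simp only [one_mul, fderiv_fun_const, Pi.zero_apply, ContinuousLinearMap.zero_apply, zero_mul,
    integral_zero, neg_zero] at this
  exact this

lemma div_form (v φ : S n) : (Ls v * φ - v * Ls φ) * t ^ n =
    ∑ i, D i (rp (2 - n) * (D i v * φ - v * D i φ)) := by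
  have e : ∀ i, D i (rp (2 - n) * (D i v * φ - v * D i φ)) =
      rp (2 - n) * (D i (D i v) * φ - v * D i (D i φ)) +
      (2 * (2 - n) : ℝ) • (rp (1 - n) * ((X i * D i v) * φ - v * (X i * D i φ))) := by
    intro i
    rw [D_mul, D_rp, map_sub, D_mul, D_mul, show (2 - n - 1 : ℝ) = 1 - n by ring]
    simp only [Algebra.smul_def]
    ring
  simp only [e, Finset.sum_add_distrib, ← Finset.smul_sum, ← Finset.mul_sum, Finset.sum_sub_distrib,
    ← Finset.sum_mul, ← Lap_apply, ← Eu_apply]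
  rw [← rpn_eq, Ls_apply, Ls_apply]
  have e1 : (rp (2 - n) : S n) = rp 2 * rp (-n) := by rw [rp_mul]; congr 1
  have e2 : (rp (1 - n) : S n) = rp 1 * rp (-n) := by rw [rp_mul]; congr 1
  rw [e1, e2]
  simp only [Algebra.smul_def, map_mul, map_sub, map_natCast, map_ofNat]
  ring

lemma sym_CS (v φ : S n) (hv : CS v) : I (Ls v * φ * t ^ n) = I (v * Ls φ * t ^ n) := by
  have h : I ((Ls v * φ - v * Ls φ) * t ^ n) = 0 := by
    rw [div_form]
    have hW : ∀ i, CS (rp (2 - n) * (D i v * φ - v * D i φ)) := fun i =>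
      CS.mul_left (((hv.D i).mul_right _).sub (hv.mul_right _)) _
    rw [I_sum _ fun i _ => ((hW i).D i).int]
    exact Finset.sum_eq_zero fun i _ => I_D i _ (hW i).int ((hW i).D i).int
  rw [sub_mul, I_sub ((hv.Ls.mul_right _).mul_right _).int ((hv.mul_right _).mul_right _).int] at h
  linarith

def B (n : ℕ) : Subalgebra ℝ (S n) :=
  Algebra.adjoin ℝ (insert t (Set.range s ∪ Set.range fun p : Fin n × Fin n => X p.1 * s p.2))

lemma t_mem_B : (t : S n) ∈ B n := Algebra.subset_adjoin (by simp)
lemma s_mem_B (i : Fin n) : (s i : S n) ∈ B n := Algebra.subset_adjoin (by simp)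
lemma u_mem_B (i j : Fin n) : (X i * s j : S n) ∈ B n :=
  Algebra.subset_adjoin (Set.mem_insert_of_mem _ (Or.inr ⟨(i, j), rfl⟩))

lemma D_t' (i : Fin n) : D i (t : S n) = t * ((-2 : ℝ) • s i) := by
  rw [D_t, s_eq]; simp only [Algebra.smul_def]; ring
lemma D_s' (i j : Fin n) : D i (s j : S n) = t * ((if i = j then 1 else 0) + (-2 : ℝ) • (X i * s j)) := by
  rw [D_s, s_eq]; simp only [Algebra.smul_def]; split_ifs <;> ring

lemma ite_mem_B (p : Prop) [Decidable p] (b : S n) (hb : b ∈ B n) : (if p then b else 0) ∈ B n := by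
  split_ifs
  · exact hb
  · exact (B n).zero_mem

lemma D_B (k : Fin n) (b : S n) (hb : b ∈ B n) : D k b ∈ B n := by
  induction hb using Algebra.adjoin_induction with
  | mem x hx =>
    have hs : ∀ j, D k (s j) ∈ B n := fun j => by
      rw [D_s']
      exact (B n).mul_mem t_mem_B ((B n).add_mem (ite_mem_B _ _ (B n).one_mem)
        ((B n).smul_mem (u_mem_B _ _) _))
    rcases hx with rfl | ⟨j, rfl⟩ | ⟨⟨i, j⟩, rfl⟩
    · rw [D_t']; exact (B n).mul_mem t_mem_B ((B n).smul_mem (s_mem_B _) _)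
    · exact hs j
    · dsimp only
      rw [D_mul, D_X]
      refine (B n).add_mem ?_ ?_
      · rw [ite_mul, one_mul, zero_mul]; exact ite_mem_B _ _ (s_mem_B _)
      · have : X i * D k (s j) = s i * ((if k = j then 1 else 0) + (-2 : ℝ) • (X k * s j)) := by
          rw [D_s', s_eq i]; ring
        rw [this]
        exact (B n).mul_mem (s_mem_B _) ((B n).add_mem (ite_mem_B _ _ (B n).one_mem)
          ((B n).smul_mem (u_mem_B _ _) _))
  | algebraMap r => rw [D_algebraMap]; exact (B n).zero_mem
  | add x y hx hy h1 h2 => rw [map_add]; exact (B n).add_mem h1 h2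
  | mul x y hx hy h1 h2 =>
    rw [D_mul]; exact (B n).add_mem ((B n).mul_mem h1 hy) ((B n).mul_mem hx h2)

lemma Valg_le_B : Valg n ≤ B n :=
  Algebra.adjoin_mono (Set.insert_subset_insert Set.subset_union_left)

lemma D_Valg (k : Fin n) (v : S n) (hv : v ∈ Valg n) : ∃ b ∈ B n, D k v = t * b := by
  induction hv using Algebra.adjoin_induction with
  | mem x hx =>
    rcases hx with rfl | ⟨j, rfl⟩
    · exact ⟨_, (B n).smul_mem (s_mem_B _) _, D_t' k⟩
    · exact ⟨_, (B n).add_mem (ite_mem_B _ _ (B n).one_mem) ((B n).smul_mem (u_mem_B _ _) _), D_s' k j⟩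
  | algebraMap r => exact ⟨0, (B n).zero_mem, by rw [D_algebraMap, mul_zero]⟩
  | add x y hx hy h1 h2 =>
    obtain ⟨b, hb, e⟩ := h1
    obtain ⟨b', hb', e'⟩ := h2
    exact ⟨b + b', (B n).add_mem hb hb', by rw [map_add, e, e', mul_add]⟩
  | mul x y hx hy h1 h2 =>
    obtain ⟨b, hb, e⟩ := h1
    obtain ⟨b', hb', e'⟩ := h2
    exact ⟨b * y + x * b', (B n).add_mem ((B n).mul_mem hb (Valg_le_B hy))
      ((B n).mul_mem (Valg_le_B hx) hb'), by rw [D_mul, e, e']; ring⟩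

lemma t_apply (x : E n) : ((t : S n) : E n → ℝ) x = (1 + ‖x‖ ^ 2)⁻¹ := by
  rw [t, rp_apply, Real.rpow_neg_one]
lemma s_apply (i : Fin n) (x : E n) : ((s i : S n) : E n → ℝ) x = x i * (1 + ‖x‖ ^ 2)⁻¹ := by
  rw [← t_apply]; rfl

lemma abs_coord_le (x : E n) (i : Fin n) : |x i| ≤ ‖x‖ := by
  simpa using PiLp.norm_apply_le x i

lemma B_bdd (b : S n) (hb : b ∈ B n) : ∃ C, ∀ x, |(b : E n → ℝ) x| ≤ C := by
  induction hb using Algebra.adjoin_induction with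
  | mem x hx =>
    rcases hx with rfl | ⟨j, rfl⟩ | ⟨⟨i, j⟩, rfl⟩
    · refine ⟨1, fun x => ?_⟩
      rw [t_apply, abs_of_nonneg (by positivity)]
      exact inv_le_one_of_one_le₀ (by nlinarith [sq_nonneg ‖x‖])
    · refine ⟨1, fun x => ?_⟩
      rw [s_apply, abs_mul, abs_of_nonneg (a := (1 + ‖x‖ ^ 2)⁻¹) (by positivity), ← div_eq_mul_inv,
        div_le_one (by positivity)]
      nlinarith [abs_coord_le x j, sq_nonneg (‖x‖ - 1), norm_nonneg x]
    · refine ⟨1, fun x => ?_⟩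
      have : ((X i * s j : S n) : E n → ℝ) x = x i * (x j * (1 + ‖x‖ ^ 2)⁻¹) := by
        rw [← s_apply]; rfl
      rw [this, abs_mul, abs_mul, abs_of_nonneg (a := (1 + ‖x‖ ^ 2)⁻¹) (by positivity), ← mul_assoc,
        ← div_eq_mul_inv, div_le_one (by positivity)]
      nlinarith [mul_le_mul (abs_coord_le x i) (abs_coord_le x j) (abs_nonneg _) (norm_nonneg x)]
  | algebraMap r => exact ⟨|r|, fun x => le_rfl⟩
  | add x y hx hy h1 h2 =>
    obtain ⟨C, h1⟩ := h1
    obtain ⟨C', h2⟩ := h2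
    exact ⟨C + C', fun z => (abs_add_le _ _).trans (add_le_add (h1 z) (h2 z))⟩
  | mul x y hx hy h1 h2 =>
    obtain ⟨C, h1⟩ := h1
    obtain ⟨C', h2⟩ := h2
    refine ⟨C * C', fun z => ?_⟩
    have : ((x * y : S n) : E n → ℝ) z = (x : E n → ℝ) z * (y : E n → ℝ) z := rfl
    rw [this, abs_mul]
    exact mul_le_mul (h1 z) (h2 z) (abs_nonneg _) ((abs_nonneg _).trans (h1 z))

lemma Int_tpow (m : ℕ) (hm : n < 2 * m) : Int (t ^ m : S n) := by
  have h := integrable_rpow_neg_one_add_norm_sq (E := E n) (μ := volume) (r := 2 * m)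
    (by rw [finrank_euclideanSpace_fin]; exact_mod_cast hm)
  rw [← rpn_eq]
  unfold Int
  convert h using 2 with x
  rw [rp_apply]; congr 1; ring

lemma Int_B (m : ℕ) (hm : n < 2 * m) (b : S n) (hb : b ∈ B n) : Int (t ^ m * b) := by
  obtain ⟨C, hC⟩ := B_bdd b hb
  refine Integrable.mul_bdd (c := C) (Int_tpow m hm) (S_cont b).aestronglyMeasurable (ae_of_all _ fun x => ?_)
  exact hC x

lemma Int_B' (hn : 1 ≤ n) (b : S n) (hb : b ∈ B n) : Int (b * t ^ n) := by
  rw [mul_comm]; exact Int_B n (by omega) b hb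

lemma D_tpow_B (i : Fin n) (m : ℕ) (b : S n) (hb : b ∈ B n) :
    ∃ b' ∈ B n, D i (t ^ m * b) = t ^ m * b' := by
  induction m generalizing b with
  | zero => exact ⟨D i b, D_B i b hb, by simp⟩
  | succ m ih =>
    obtain ⟨b', hb', e⟩ := ih b hb
    refine ⟨(-2 : ℝ) • s i * b + b', (B n).add_mem ((B n).mul_mem ((B n).smul_mem (s_mem_B _) _) hb) hb', ?_⟩
    rw [pow_succ', mul_assoc, D_mul, e, D_t']; ring

lemma Ls_Valg (v : S n) (hv : v ∈ Valg n) : Ls v ∈ Valg n := by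
  obtain ⟨d, hd⟩ := Valg_le v hv
  have h1 := Ls_pow d v (V1_pow_le d hd)
  have h2 := (Valg n).sub_mem (V1_pow_le_Valg d _ h1) ((Valg n).smul_mem hv (lam n (d + 1)))
  simpa using h2

lemma sym3 (hn : 3 ≤ n) (v φ : S n) (hv : v ∈ Valg n) (hφ : φ ∈ Valg n) :
    I ((Ls v * φ - v * Ls φ) * t ^ n) = 0 := by
  rw [div_form]
  have hW : ∀ i, ∃ b ∈ B n, rp (2 - n) * (D i v * φ - v * D i φ) = t ^ (n - 1) * b := fun i => by
    obtain ⟨b, hb, e⟩ := D_Valg i v hv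
    obtain ⟨b', hb', e'⟩ := D_Valg i φ hφ
    refine ⟨b * φ - v * b', (B n).sub_mem ((B n).mul_mem hb (Valg_le_B hφ))
      ((B n).mul_mem (Valg_le_B hv) hb'), ?_⟩
    have : (rp (2 - n) : S n) = t ^ (n - 2) := by
      rw [← rpn_eq]; congr 1; rw [Nat.cast_sub (by omega)]; push_cast; ring
    rw [e, e', this, show n - 1 = n - 2 + 1 by omega, pow_succ]; ring
  have h1 : ∀ i, Int (rp (2 - n) * (D i v * φ - v * D i φ)) := fun i => by
    obtain ⟨b, hb, e⟩ := hW i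
    rw [e]; exact Int_B _ (by omega) b hb
  have h2 : ∀ i, Int (D i (rp (2 - n) * (D i v * φ - v * D i φ))) := fun i => by
    obtain ⟨b, hb, e⟩ := hW i
    obtain ⟨b', hb', e'⟩ := D_tpow_B i (n - 1) b hb
    rw [e, e']; exact Int_B _ (by omega) b' hb'
  rw [I_sum _ fun i _ => h2 i]
  exact Finset.sum_eq_zero fun i _ => I_D i _ (h1 i) (h2 i)

end WL

namespace WL
open MeasureTheory Filter Topology
variable {n : ℕ}

lemma t_tendsto : Tendsto ((t : S n) : E n → ℝ) (cocompact (E n)) (𝓝 0) := by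
  have h : Tendsto (fun x : E n => (1 + ‖x‖ ^ 2)⁻¹) (cocompact (E n)) (𝓝 0) := by
    apply tendsto_inv_atTop_zero.comp
    apply tendsto_atTop_add_const_left
    exact (tendsto_pow_atTop two_ne_zero).comp (tendsto_norm_cocompact_atTop (E := E n))
  convert h using 2 with x
  exact t_apply x

lemma s_tendsto (i : Fin n) : Tendsto ((s i : S n) : E n → ℝ) (cocompact (E n)) (𝓝 0) := by
  have h : Tendsto (fun x : E n => ‖x‖⁻¹) (cocompact (E n)) (𝓝 0) :=
    tendsto_inv_atTop_zero.comp (tendsto_norm_cocompact_atTop (E := E n))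
  refine squeeze_zero_norm (fun x => ?_) h
  rw [s_apply, Real.norm_eq_abs, abs_mul, abs_of_nonneg (a := (1 + ‖x‖ ^ 2)⁻¹) (by positivity)]
  rcases eq_or_lt_of_le (norm_nonneg x) with h0 | h0
  · have := abs_coord_le x i
    rw [← h0] at this ⊢
    have h1 : |x i| = 0 := le_antisymm this (abs_nonneg _)
    simp [h1]
  · rw [← div_eq_mul_inv, div_le_iff₀ (by positivity)]
    have := abs_coord_le x i
    have e : ‖x‖⁻¹ * (1 + ‖x‖ ^ 2) = ‖x‖⁻¹ + ‖x‖ := by field_simp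
    rw [e]
    have : 0 < ‖x‖⁻¹ := by positivity
    linarith

lemma Valg_tendsto (f : S n) (hf : f ∈ Valg n) :
    ∃ L, Tendsto (f : E n → ℝ) (cocompact (E n)) (𝓝 L) := by
  induction hf using Algebra.adjoin_induction with
  | mem x hx =>
    rcases hx with rfl | ⟨j, rfl⟩
    · exact ⟨0, t_tendsto⟩
    · exact ⟨0, s_tendsto j⟩
  | algebraMap r => exact ⟨r, tendsto_const_nhds⟩
  | add x y hx hy h1 h2 =>
    obtain ⟨b, hb⟩ := h1
    obtain ⟨b', hb'⟩ := h2
    exact ⟨_, hb.add hb'⟩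
  | mul x y hx hy h1 h2 =>
    obtain ⟨b, hb⟩ := h1
    obtain ⟨b', hb'⟩ := h2
    exact ⟨_, hb.mul hb'⟩

lemma t_mem_Valg : (t : S n) ∈ Valg n := Algebra.subset_adjoin (by simp)
lemma s_mem_Valg (i : Fin n) : (s i : S n) ∈ Valg n := Algebra.subset_adjoin (by simp)

lemma rpD_one (v : S 1) (hv : v ∈ Valg 1) : rp 1 * D 0 v ∈ Valg 1 := by
  induction hv using Algebra.adjoin_induction with
  | mem x hx =>
    rcases hx with rfl | ⟨j, rfl⟩
    · rw [D_t', ← mul_assoc, rp1_t, one_mul]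
      exact (Valg 1).smul_mem (s_mem_Valg 0) _
    · obtain rfl := Subsingleton.elim 0 j
      have e : (X 0 * s 0 : S 1) = 1 - t := by
        have h := sum_X (n := 1)
        rw [Fin.sum_univ_one] at h
        rw [s_eq, ← mul_assoc, h, sub_mul, rp1_t, one_mul]
      rw [D_s', e, ← mul_assoc, rp1_t, one_mul, if_pos rfl]
      exact (Valg 1).add_mem (Valg 1).one_mem
        ((Valg 1).smul_mem ((Valg 1).sub_mem (Valg 1).one_mem t_mem_Valg) _)
  | algebraMap r => rw [D_algebraMap, mul_zero]; exact (Valg 1).zero_mem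
  | add x y hx hy h1 h2 => rw [map_add, mul_add]; exact (Valg 1).add_mem h1 h2
  | mul x y hx hy h1 h2 =>
    rw [D_mul, mul_add, ← mul_assoc, mul_left_comm]
    exact (Valg 1).add_mem ((Valg 1).mul_mem h1 hy) ((Valg 1).mul_mem hx h2)

lemma I_D_one (W : S 1) (hW : W ∈ Valg 1) (hI : Int (D 0 W)) : I (D 0 W) = 0 := by
  obtain ⟨L, hL⟩ := Valg_tendsto W hW
  set e : ℝ ≃ₗᵢ[ℝ] E 1 := (OrthonormalBasis.singleton (Fin 1) ℝ).repr with he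
  have he1 : e 1 = EuclideanSpace.single 0 1 := by
    ext i
    obtain rfl := Subsingleton.elim 0 i
    refine ((OrthonormalBasis.singleton (Fin 1) ℝ).repr_apply_apply 1 0).trans ?_
    simp
  have hmp : MeasurePreserving e volume volume := e.measurePreserving
  have hemb : MeasurableEmbedding e := e.toHomeomorph.measurableEmbedding
  unfold I
  rw [← hmp.integral_comp hemb]
  have hd : ∀ r : ℝ, HasDerivAt (fun r => (W : E 1 → ℝ) (e r)) ((D 0 W : E 1 → ℝ) (e r)) r := by
    intro r
    have h1 : HasDerivAt (fun r => e r) (e 1) r := e.toContinuousLinearEquiv.toContinuousLinearMap.hasDerivAt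
    have h2 := (S_diff W (e r)).hasFDerivAt.comp_hasDerivAt r h1
    rw [he1] at h2
    exact h2
  have hc : Tendsto e (cocompact ℝ) (cocompact (E 1)) := e.toHomeomorph.isClosedEmbedding.tendsto_cocompact
  have := integral_of_hasDerivAt_of_tendsto hd
    ((hmp.integrable_comp_emb hemb).2 hI)
    ((hL.comp hc).mono_left atBot_le_cocompact) ((hL.comp hc).mono_left atTop_le_cocompact)
  rw [this, sub_self]

lemma sym1 (v φ : S 1) (hv : v ∈ Valg 1) (hφ : φ ∈ Valg 1) :
    I ((Ls v * φ - v * Ls φ) * t ^ 1) = 0 := by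
  have h := div_form v φ
  rw [Fin.sum_univ_one, show (2 - ((1 : ℕ) : ℝ)) = 1 by norm_num] at h
  have hi : Int ((Ls v * φ - v * Ls φ) * t ^ 1) := Int_B' le_rfl _ (Valg_le_B
    ((Valg 1).sub_mem ((Valg 1).mul_mem (Ls_Valg v hv) hφ) ((Valg 1).mul_mem hv (Ls_Valg φ hφ))))
  rw [h] at hi ⊢
  refine I_D_one _ ?_ hi
  rw [mul_sub, ← mul_assoc, mul_left_comm]
  exact (Valg 1).sub_mem ((Valg 1).mul_mem (rpD_one v hv) hφ) ((Valg 1).mul_mem hv (rpD_one φ hφ))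

lemma sym_V (hn : n = 1 ∨ 3 ≤ n) (v φ : S n) (hv : v ∈ Valg n) (hφ : φ ∈ Valg n) :
    I (Ls v * φ * t ^ n) = I (v * Ls φ * t ^ n) := by
  have h : I ((Ls v * φ - v * Ls φ) * t ^ n) = 0 := by
    rcases hn with rfl | hn
    · exact sym1 v φ hv hφ
    · exact sym3 hn v φ hv hφ
  have h1 : 1 ≤ n := by omega
  rw [sub_mul, I_sub (Int_B' h1 _ (Valg_le_B ((Valg n).mul_mem (Ls_Valg v hv) hφ)))
    (Int_B' h1 _ (Valg_le_B ((Valg n).mul_mem hv (Ls_Valg φ hφ))))] at h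
  linarith

lemma orth (hn : n = 1 ∨ 3 ≤ n) (φ : ℕ → S n) (hφ : ∀ l, φ l ∈ Valg n)
    (he : ∀ l, Ls (φ l) = (-lam n l) • φ l) {l m : ℕ} (hlm : l ≠ m) :
    I (φ l * φ m * t ^ n) = 0 := by
  have h := sym_V hn (φ l) (φ m) (hφ l) (hφ m)
  rw [he, he, smul_mul_assoc, smul_mul_assoc, mul_smul_comm, smul_mul_assoc, I_smul, I_smul] at h
  have h1 : 1 ≤ n := by omega
  have hne : lam n l ≠ lam n m := by
    rcases lt_or_gt_of_ne hlm with h' | h'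
    · exact (lam_lt h1 h').ne
    · exact (lam_lt h1 h').ne'
  have : (lam n m - lam n l) * I (φ l * φ m * t ^ n) = 0 := by linarith
  exact (mul_eq_zero.1 this).resolve_left (sub_ne_zero.2 hne.symm)

def mu (n l m : ℕ) : ℝ := ∏ j ∈ Finset.range m, (4 * j * (j + 1) - n * (n - 2) - lam n l)

lemma T_pair (v φ : S n) (hv : CS v) (l : ℕ) (he : Ls φ = (-lam n l) • φ) (m : ℕ) :
    I (T v m * φ * t ^ n) = mu n l m * I (v * φ * t ^ n) := by
  induction m with
  | zero => simp [T, mu]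
  | succ m ih =>
    rw [T, add_mul, add_mul, I_add ((((hv.T m).Ls).mul_right _).mul_right _).int
      ((((hv.T m).smul _).mul_right _).mul_right _).int, sym_CS _ _ (hv.T m), he,
      mul_smul_comm, smul_mul_assoc, smul_mul_assoc, smul_mul_assoc, I_smul, I_smul, ih, mu, mu,
      Finset.prod_range_succ]
    ring

def fm (m : ℕ) (N : ℝ) : ℝ := ∏ j ∈ Finset.range m, (|N - 2 * (j + 1)| * (N + 2 * j))

lemma mu_abs (hn : 1 ≤ n) (l m : ℕ) : |mu n l m| = fm m (2 * l + n) := by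
  rw [mu, fm, Finset.abs_prod]
  refine Finset.prod_congr rfl fun j _ => ?_
  have : (4 * j * (j + 1) - n * (n - 2) - lam n l : ℝ) =
      -((2 * l + n - 2 * (j + 1)) * (2 * l + n + 2 * j)) := by
    unfold lam; ring
  rw [this, abs_neg, abs_mul, abs_of_nonneg (a := (2 * l + n + 2 * j : ℝ)) (by positivity)]

lemma fm_id (m : ℕ) (N : ℝ) : fm m (N + 2) * (N * |N - 2 * m|) = fm m N * (|N| * (N + 2 * m)) := by
  induction m with
  | zero => simp [fm]; ring
  | succ m ih =>
    unfold fm at *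
    rw [Finset.prod_range_succ, Finset.prod_range_succ]
    have e : |N + 2 - 2 * ((m : ℝ) + 1)| = |N - 2 * m| := by congr 1; ring
    rw [e]
    push_cast
    linear_combination (N + 2 + 2 * m) * |N - 2 * (m + 1)| * ih

lemma fm_nonneg (m : ℕ) (N : ℝ) (hN : 0 ≤ N) : 0 ≤ fm m N :=
  Finset.prod_nonneg fun j _ => by positivity

lemma fm_mono (m : ℕ) (N : ℝ) (hN : 0 < N) (hne : N ≠ 2 * m) : fm m N ≤ fm m (N + 2) := by
  have h := fm_id m N
  rw [abs_of_pos hN] at h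
  have h' : fm m (N + 2) * |N - 2 * m| = fm m N * (N + 2 * m) := by
    have : N * (fm m (N + 2) * |N - 2 * m| - fm m N * (N + 2 * m)) = 0 := by linarith
    have := (mul_eq_zero.1 this).resolve_left hN.ne'
    linarith
  have hp : 0 < |N - 2 * m| := abs_pos.2 (sub_ne_zero.2 hne)
  have hm : (0 : ℝ) ≤ m := Nat.cast_nonneg _
  have hle : |N - 2 * m| ≤ N + 2 * m := abs_le.2 ⟨by linarith, by linarith⟩
  have h0 := fm_nonneg m N hN.le
  by_contra hlt
  push Not at hlt
  nlinarith [mul_le_mul_of_nonneg_left hle h0, mul_lt_mul_of_pos_right hlt hp]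

lemma fm_le (hn : 1 ≤ n) (m : ℕ) (hm : Even n → 2 * m < n) (l : ℕ) : fm m n ≤ fm m (2 * l + n) := by
  induction l with
  | zero => simp
  | succ l ih =>
    refine ih.trans ?_
    have h := fm_mono m (2 * l + n) (by positivity) (by
      intro h
      have h' : 2 * l + n = 2 * m := by exact_mod_cast h
      have := hm ⟨m - l, by omega⟩
      omega)
    rwa [show (2 * ((l + 1 : ℕ) : ℝ) + n) = 2 * l + n + 2 by push_cast; ring]

lemma fm_pos (hn : 1 ≤ n) (m : ℕ) (hm : Even n → 2 * m < n) : 0 < fm m n := by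
  refine Finset.prod_pos fun j hj => ?_
  have h1 : (0 : ℝ) < n := by exact_mod_cast hn
  refine mul_pos (abs_pos.2 (sub_ne_zero.2 ?_)) (by positivity)
  intro h
  have h' : n = 2 * (j + 1) := by exact_mod_cast h
  have := hm ⟨j + 1, by omega⟩
  have := Finset.mem_range.1 hj
  omega

end WL

namespace WL
open MeasureTheory Filter Topology
variable {n : ℕ}

def ext (f : S n) (h : Tendsto (f : E n → ℝ) (cocompact (E n)) (𝓝 0)) : C(OnePoint (E n), ℝ) :=
  OnePoint.continuousMapMk ⟨(f : E n → ℝ), S_cont f⟩ 0 (by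
    rw [coclosedCompact_eq_cocompact]; exact h)

lemma ext_coe (f : S n) (h) (x : E n) : ext f h (x : OnePoint (E n)) = (f : E n → ℝ) x := rfl
lemma ext_infty (f : S n) (h) : ext f h (OnePoint.infty) = 0 := rfl

def A (n : ℕ) : Subalgebra ℝ C(OnePoint (E n), ℝ) :=
  Algebra.adjoin ℝ (insert (ext t t_tendsto) (Set.range fun i => ext (s i) (s_tendsto i)))

lemma A_prop (g : C(OnePoint (E n), ℝ)) (hg : g ∈ A n) :
    ∃ f ∈ Valg n, ∀ x : E n, g (x : OnePoint (E n)) = (f : E n → ℝ) x := by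
  induction hg using Algebra.adjoin_induction with
  | mem x hx =>
    rcases hx with rfl | ⟨j, rfl⟩
    · exact ⟨t, t_mem_Valg, fun x => rfl⟩
    · exact ⟨s j, s_mem_Valg j, fun x => rfl⟩
  | algebraMap r => exact ⟨algebraMap ℝ _ r, (Valg n).algebraMap_mem r, fun x => rfl⟩
  | add x y hx hy h1 h2 =>
    obtain ⟨b, hb, e⟩ := h1
    obtain ⟨b', hb', e'⟩ := h2
    exact ⟨b + b', (Valg n).add_mem hb hb', fun z => congrArg₂ (· + ·) (e z) (e' z)⟩
  | mul x y hx hy h1 h2 =>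
    obtain ⟨b, hb, e⟩ := h1
    obtain ⟨b', hb', e'⟩ := h2
    exact ⟨b * b', (Valg n).mul_mem hb hb', fun z => congrArg₂ (· * ·) (e z) (e' z)⟩

lemma A_sep : (A n).SeparatesPoints := by
  have ht : ∀ x y, ext (n := n) t t_tendsto x ≠ ext t t_tendsto y →
      ∃ f ∈ ((fun f : C(OnePoint (E n), ℝ) => (f : OnePoint (E n) → ℝ)) '' (A n : Set _)), f x ≠ f y :=
    fun x y h => ⟨_, ⟨_, Algebra.subset_adjoin (Set.mem_insert _ _), rfl⟩, h⟩
  intro x y hxy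
  by_cases h : ext (n := n) t t_tendsto x = ext t t_tendsto y
  swap
  · exact ht x y h
  have hpos : ∀ x : E n, 0 < ((t : S n) : E n → ℝ) x := fun x => by rw [t_apply]; positivity
  induction x using OnePoint.rec with
  | infty =>
    induction y using OnePoint.rec with
    | infty => exact absurd rfl hxy
    | coe y =>
      rw [ext_coe, ext_infty] at h
      exact absurd h (hpos y).ne
  | coe x =>
    induction y using OnePoint.rec with
    | infty =>
      rw [ext_coe, ext_infty] at h
      exact absurd h (hpos x).ne'
    | coe y =>
      rw [ext_coe, ext_coe] at h
      have hne : x ≠ y := fun e => hxy (by rw [e])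
      obtain ⟨i, hi⟩ : ∃ i, x i ≠ y i := by
        by_contra hcon
        push Not at hcon
        exact hne (PiLp.ext hcon)
      refine ⟨_, ⟨_, Algebra.subset_adjoin (Set.mem_insert_of_mem _ ⟨i, rfl⟩), rfl⟩, ?_⟩
      change x i * ((t : S n) : E n → ℝ) x ≠ y i * ((t : S n) : E n → ℝ) y
      rw [← h]
      intro e
      exact hi (mul_right_cancel₀ (hpos x).ne' e)

lemma density (v : S n) (hv : CS v) (ε : ℝ) (hε : 0 < ε) :
    ∃ φ ∈ Valg n, ∀ x, |(φ : E n → ℝ) x - (v : E n → ℝ) x| < ε := by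
  have h0 : Tendsto (v : E n → ℝ) (cocompact (E n)) (𝓝 0) := by
    have := hasCompactSupport_iff_eventuallyEq.1 hv
    rw [coclosedCompact_eq_cocompact] at this
    exact tendsto_const_nhds.congr' this.symm
  obtain ⟨⟨g, hg⟩, h⟩ := ContinuousMap.exists_mem_subalgebra_near_continuous_of_separatesPoints
    (A n) A_sep (ext v h0) (ext v h0).continuous ε hε
  obtain ⟨f, hf, e⟩ := A_prop g hg
  refine ⟨f, hf, fun x => ?_⟩
  have := h (x : OnePoint (E n))
  rw [ext_coe] at this
  rw [← e]; exact this

lemma I_nonneg (f : S n) (h : ∀ x, 0 ≤ (f : E n → ℝ) x) : 0 ≤ I f := integral_nonneg h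
lemma I_mono (f g : S n) (hf : Int f) (hg : Int g) (h : ∀ x, (f : E n → ℝ) x ≤ (g : E n → ℝ) x) :
    I f ≤ I g := integral_mono hf hg h

lemma tn_pos (m : ℕ) (x : E n) : 0 ≤ ((t ^ m : S n) : E n → ℝ) x := by
  change 0 ≤ (((t : S n) : E n → ℝ) x) ^ m
  rw [t_apply]; positivity

lemma I_sq_nonneg (f : S n) : 0 ≤ I (f * f * t ^ n) :=
  I_nonneg _ fun x => mul_nonneg (mul_self_nonneg ((f : E n → ℝ) x)) (tn_pos n x)

lemma key_finite (hn : n = 1 ∨ 3 ≤ n) (m : ℕ) (hm : Even n → 2 * m < n) (v : S n) (hv : CS v)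
    (Q : S n) (hQ : Q ∈ Valg n) :
    fm m n ^ 2 * (I (v * v * t ^ n) - I ((v - Q) * (v - Q) * t ^ n)) ≤
      I (T v m * T v m * t ^ n) := by
  have h1 : 1 ≤ n := by omega
  obtain ⟨d, hd⟩ := Valg_le Q hQ
  obtain ⟨φ, hφ, he, hsum⟩ := decomp h1 d Q hd
  have hφV : ∀ l, φ l ∈ Valg n := fun l => V1_pow_le_Valg d _ (hφ l)
  set c := fm m n with hc
  have hcpos : 0 < c := fm_pos h1 m hm
  have hmu : ∀ l, c ≤ |mu n l m| := fun l => by rw [mu_abs h1]; exact fm_le h1 m hm l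
  have hmu0 : ∀ l, mu n l m ≠ 0 := fun l => abs_pos.1 (hcpos.trans_le (hmu l))
  set ψ : S n := ∑ l ∈ Finset.range (d + 1), (mu n l m)⁻¹ • φ l with hψ
  have hψV : ψ ∈ Valg n := (Valg n).sum_mem fun l _ => (Valg n).smul_mem (hφV l) _
  have iV : ∀ f ∈ Valg n, Int (f * t ^ n) := fun f hf => Int_B' h1 _ (Valg_le_B hf)
  have iC : ∀ w : S n, CS w → ∀ f, Int (w * f * t ^ n) := fun w hw f =>
    ((hw.mul_right _).mul_right _).int
  -- pairing
  have e1 : I (T v m * ψ * t ^ n) = I (v * Q * t ^ n) := by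
    rw [hψ, hsum, Finset.mul_sum, Finset.mul_sum, Finset.sum_mul, Finset.sum_mul,
      I_sum _ fun l _ => iC _ (hv.T m) _, I_sum _ fun l _ => iC _ hv _]
    refine Finset.sum_congr rfl fun l _ => ?_
    rw [mul_smul_comm, smul_mul_assoc, I_smul, T_pair v _ hv l (he l), ← mul_assoc,
      inv_mul_cancel₀ (hmu0 l), one_mul]
  have dbl : ∀ a : ℕ → ℝ, I ((∑ l ∈ Finset.range (d + 1), a l • φ l) *
      (∑ l ∈ Finset.range (d + 1), a l • φ l) * t ^ n) =
      ∑ l ∈ Finset.range (d + 1), a l ^ 2 * I (φ l * φ l * t ^ n) := by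
    intro a
    rw [Finset.sum_mul_sum, Finset.sum_mul]
    have hi : ∀ l k, Int (a l • φ l * a k • φ k * t ^ n) := fun l k =>
      iV _ ((Valg n).mul_mem ((Valg n).smul_mem (hφV l) _) ((Valg n).smul_mem (hφV k) _))
    simp only [Finset.sum_mul]
    rw [I_sum _ fun l _ => Int.sum _ fun k _ => hi l k]
    refine Finset.sum_congr rfl fun l hl => ?_
    rw [I_sum _ fun k _ => hi l k, Finset.sum_eq_single l]
    · rw [smul_mul_smul_comm, smul_mul_assoc, I_smul]; ring
    · intro k _ hk
      rw [smul_mul_smul_comm, smul_mul_assoc, I_smul, orth hn φ hφV he hk.symm, mul_zero]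
    · intro h; exact absurd hl h
  have e2 : c ^ 2 * I (ψ * ψ * t ^ n) ≤ I (Q * Q * t ^ n) := by
    have hQ1 := dbl (fun _ => 1)
    simp only [one_smul, one_pow, one_mul, ← hsum] at hQ1
    rw [hQ1, hψ, dbl, Finset.mul_sum]
    refine Finset.sum_le_sum fun l _ => ?_
    rw [← mul_assoc]
    refine mul_le_of_le_one_left (I_sq_nonneg _) ?_
    rw [inv_pow, ← div_eq_mul_inv, div_le_one (by have := hmu0 l; positivity), ← sq_abs (mu n l m)]
    exact pow_le_pow_left₀ hcpos.le (hmu l) 2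
  have e3 : 0 ≤ I ((T v m - (c ^ 2) • ψ) * (T v m - (c ^ 2) • ψ) * t ^ n) := I_sq_nonneg _
  have x3 : (T v m - (c ^ 2) • ψ) * (T v m - (c ^ 2) • ψ) * t ^ n =
      T v m * T v m * t ^ n - (2 * c ^ 2) • (T v m * ψ * t ^ n) + (c ^ 4) • (ψ * ψ * t ^ n) := by
    simp only [Algebra.smul_def, map_mul, map_ofNat, map_pow]; ring
  have x4 : (v - Q) * (v - Q) * t ^ n =
      v * v * t ^ n - (2 : ℝ) • (v * Q * t ^ n) + Q * Q * t ^ n := by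
    simp only [Algebra.smul_def, map_ofNat]; ring
  have iψ := iV _ ((Valg n).mul_mem hψV hψV)
  have iQ := iV _ ((Valg n).mul_mem hQ hQ)
  rw [x3, I_add ((iC _ (hv.T m) _).sub ((iC _ (hv.T m) _).smul _)) (iψ.smul _),
    I_sub (iC _ (hv.T m) _) ((iC _ (hv.T m) _).smul _), I_smul, I_smul, e1] at e3
  rw [x4, I_add ((iC _ hv _).sub ((iC _ hv _).smul _)) iQ,
    I_sub (iC _ hv _) ((iC _ hv _).smul _), I_smul]
  have hc2 : 0 ≤ c ^ 2 := sq_nonneg c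
  nlinarith [mul_le_mul_of_nonneg_left e2 hc2]

lemma scalar (hn : n = 1 ∨ 3 ≤ n) (m : ℕ) (hm : Even n → 2 * m < n) (v : S n) (hv : CS v) :
    fm m n ^ 2 * I (v * v * t ^ n) ≤ I (T v m * T v m * t ^ n) := by
  have h1 : 1 ≤ n := by omega
  have it : Int (t ^ n : S n) := Int_tpow n (by omega)
  have hlim : Tendsto (fun ε : ℝ => fm m n ^ 2 * (I (v * v * t ^ n) - ε ^ 2 * I (t ^ n : S n)))
      (𝓝[>] 0) (𝓝 (fm m n ^ 2 * (I (v * v * t ^ n) - 0 ^ 2 * I (t ^ n : S n)))) := by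
    apply Tendsto.mono_left _ nhdsWithin_le_nhds
    exact Continuous.tendsto (by fun_prop) 0
  rw [zero_pow two_ne_zero, zero_mul, sub_zero] at hlim
  refine le_of_tendsto hlim ?_
  filter_upwards [self_mem_nhdsWithin] with ε hε
  obtain ⟨Q, hQ, hQε⟩ := density v hv ε hε
  refine le_trans ?_ (key_finite hn m hm v hv Q hQ)
  refine mul_le_mul_of_nonneg_left (sub_le_sub_left ?_ _) (sq_nonneg _)
  rw [← I_smul]
  refine I_mono _ _ ?_ (it.smul _) fun x => ?_
  · have : (v - Q) * (v - Q) * t ^ n = v * (v - 2 * Q) * t ^ n + Q * Q * t ^ n := by ring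
    rw [this]
    exact ((hv.mul_right _).mul_right _).int.add (Int_B' h1 _ (Valg_le_B ((Valg n).mul_mem hQ hQ)))
  · change ((v : E n → ℝ) x - (Q : E n → ℝ) x) * ((v : E n → ℝ) x - (Q : E n → ℝ) x) *
      ((t ^ n : S n) : E n → ℝ) x ≤ ε ^ 2 * ((t ^ n : S n) : E n → ℝ) x
    refine mul_le_mul_of_nonneg_right ?_ (tn_pos n x)
    have := abs_lt.1 (hQε x)
    nlinarith

end WL

namespace WL
open MeasureTheory Filter Topology
variable {n : ℕ}

lemma CS.Lap {f : S n} (h : CS f) : CS (Lap f) := by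
  rw [Lap_apply]; exact CS.sum _ fun i => (h.D i).D i

lemma CS.LapIter {f : S n} (h : CS f) (m : ℕ) : CS (WL.Lap^[m] f) := by
  induction m with
  | zero => exact h
  | succ m ih => rw [Function.iterate_succ_apply']; exact ih.Lap

lemma scalar_h (hn : n = 1 ∨ 3 ≤ n) (m : ℕ) (hm : Even n → 2 * m < n) (h : S n) (hh : CS h) :
    fm m n ^ 2 * I (h * h * rp (-(2 * m))) ≤ I (Lap^[m] h * Lap^[m] h * rp (2 * m)) := by
  have key := scalar hn m hm (rp (n / 2 - m) * h) (hh.mul_left _)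
  have hf := factorization m (rp (n / 2 - m) * h)
  rw [← mul_assoc, rp_mul, show (m - n / 2 + (n / 2 - m) : ℝ) = 0 by ring, rp_zero, one_mul] at hf
  have e1 : rp (n / 2 - m) * h * (rp (n / 2 - m) * h) * t ^ n = h * h * rp (-(2 * m)) := by
    rw [← rpn_eq]
    have : (rp (n / 2 - m) * rp (n / 2 - m) * rp (-n) : S n) = rp (-(2 * m)) := by
      rw [rp_mul, rp_mul]; congr 1; ring
    rw [← this]; ring
  have e2 : T (rp (n / 2 - m) * h) m * T (rp (n / 2 - m) * h) m * t ^ n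
      = Lap^[m] h * Lap^[m] h * rp (2 * m) := by
    rw [← rpn_eq, hf]
    have : (rp (-m - n / 2) * rp (-m - n / 2) * rp (2 * m) : S n) = rp (-n) := by
      rw [rp_mul, rp_mul]; congr 1; ring
    rw [← this]; ring
  rwa [e1, e2] at key

section
variable {F : Type*} [NormedAddCommGroup F] [NormedSpace ℝ F]

lemma smooth_laplacian {h : E n → F} (hs : ContDiff ℝ (⊤ : ℕ∞) h) :
    ContDiff ℝ (⊤ : ℕ∞) (laplacian h) := by
  unfold laplacian
  exact ContDiff.sum fun j _ => contDiff_pd (contDiff_pd hs _) _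

/-- component -/
def comp (L : F →L[ℝ] ℝ) (h : E n → F) (hs : ContDiff ℝ (⊤ : ℕ∞) h) : S n :=
  ⟨fun x => L (h x), mem_S.2 (L.contDiff.comp hs)⟩

lemma comp_apply (L : F →L[ℝ] ℝ) (h : E n → F) (hs : ContDiff ℝ (⊤ : ℕ∞) h) (x : E n) :
    (comp L h hs : E n → ℝ) x = L (h x) := rfl

lemma D_comp (L : F →L[ℝ] ℝ) (h : E n → F) (hs : ContDiff ℝ (⊤ : ℕ∞) h) (i : Fin n) :
    D i (comp L h hs) = comp L (fun x => fderiv ℝ h x (EuclideanSpace.single i 1)) (contDiff_pd hs _) := by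
  apply Subtype.ext; funext x
  rw [D_apply, comp_apply]
  have hd : DifferentiableAt ℝ h x := hs.differentiable (by simp) x
  have : HasFDerivAt (comp L h hs : E n → ℝ) (L.comp (fderiv ℝ h x)) x :=
    L.hasFDerivAt.comp x hd.hasFDerivAt
  rw [this.fderiv]; rfl

lemma Lap_comp (L : F →L[ℝ] ℝ) (h : E n → F) (hs : ContDiff ℝ (⊤ : ℕ∞) h) :
    Lap (comp L h hs) = comp L (laplacian h) (smooth_laplacian hs) := by
  rw [Lap_apply]
  simp only [D_comp]
  apply Subtype.ext; funext x
  rw [comp_apply, laplacian, map_sum, AddSubmonoidClass.coe_finsetSum, Finset.sum_apply]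
  rfl

lemma LapIter_comp (L : F →L[ℝ] ℝ) (m : ℕ) (h : E n → F) (hs : ContDiff ℝ (⊤ : ℕ∞) h) (x : E n) :
    (Lap^[m] (comp L h hs) : E n → ℝ) x = L (laplacian^[m] h x) := by
  induction m generalizing h with
  | zero => rfl
  | succ m ih =>
    rw [Function.iterate_succ_apply, Function.iterate_succ_apply, Lap_comp, ih]

end

lemma fm_eq (m : ℕ) (N : ℝ) :
    ∏ j ∈ Finset.Icc 1 m, ((N + 2 * j - 2) * |N - 2 * j|) = fm m N := by
  induction m with
  | zero => simp [fm]
  | succ m ih =>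
    rw [Finset.prod_Icc_succ_top (by omega), ih, fm, fm, Finset.prod_range_succ]
    push_cast; ring

lemma main (hn : n = 1 ∨ 3 ≤ n) (m : ℕ) (hm : Even n → 2 * m < n) (F : Type*)
    [NormedAddCommGroup F] [InnerProductSpace ℝ F] [FiniteDimensional ℝ F]
    (h : E n → F) (hs : ContDiff ℝ (⊤ : ℕ∞) h) (hc : HasCompactSupport h) :
    fm m n ^ 2 * ∫ x, ‖h x‖ ^ 2 / (1 + ‖x‖ ^ 2) ^ (2 * m) ≤
      ∫ x, ‖laplacian^[m] h x‖ ^ 2 * (1 + ‖x‖ ^ 2) ^ (2 * m) := by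
  set b := stdOrthonormalBasis ℝ F with hb
  set g : Fin (Module.finrank ℝ F) → S n := fun i => comp (innerSL ℝ (b i)) h hs with hg
  have gCS : ∀ i, CS (g i) := fun i =>
    HasCompactSupport.comp_left (g := fun y => innerSL ℝ (b i) y) hc (map_zero _)
  have nrm : ∀ y : F, ‖y‖ ^ 2 = ∑ i, innerSL ℝ (b i) y * innerSL ℝ (b i) y := fun y => by
    rw [← b.sum_sq_norm_inner_right y]
    refine Finset.sum_congr rfl fun i _ => ?_
    rw [Real.norm_eq_abs, sq_abs, innerSL_apply_apply, sq]
  have e1 : ∫ x, ‖h x‖ ^ 2 / (1 + ‖x‖ ^ 2) ^ (2 * m) = ∑ i, I (g i * g i * rp (-(2 * m))) := by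
    rw [← I_sum _ fun i _ => (((gCS i).mul_right _).mul_right _).int]
    refine integral_congr_ae (ae_of_all _ fun x => ?_)
    dsimp only
    rw [← Finset.sum_mul]
    change _ = ((∑ i, g i * g i : S n) : E n → ℝ) x * ((rp (-(2 * m)) : S n) : E n → ℝ) x
    rw [AddSubmonoidClass.coe_finsetSum, Finset.sum_apply, nrm, rp_apply,
      Real.rpow_neg (by positivity), div_eq_mul_inv]
    congr 2
    rw [← Real.rpow_natCast]; push_cast; rfl
  have e2 : ∫ x, ‖laplacian^[m] h x‖ ^ 2 * (1 + ‖x‖ ^ 2) ^ (2 * m) =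
      ∑ i, I (Lap^[m] (g i) * Lap^[m] (g i) * rp (2 * m)) := by
    rw [← I_sum _ fun i _ => ((((gCS i).LapIter m).mul_right _).mul_right _).int]
    refine integral_congr_ae (ae_of_all _ fun x => ?_)
    dsimp only
    rw [← Finset.sum_mul]
    change _ = ((∑ i, Lap^[m] (g i) * Lap^[m] (g i) : S n) : E n → ℝ) x *
      ((rp (2 * m) : S n) : E n → ℝ) x
    rw [AddSubmonoidClass.coe_finsetSum, Finset.sum_apply, nrm, rp_apply]
    congr 1
    · refine Finset.sum_congr rfl fun i _ => ?_
      change _ = (Lap^[m] (g i) : E n → ℝ) x * (Lap^[m] (g i) : E n → ℝ) x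
      rw [hg, LapIter_comp]
    · rw [← Real.rpow_natCast]; push_cast; rfl
  rw [e1, e2, Finset.mul_sum]
  exact Finset.sum_le_sum fun i _ => scalar_h hn m hm (g i) (gCS i)

end WL

/-- The sharp weighted inequality for even powers of the Dirac operator, i.e. for
powers of the Laplacian: for `n ≥ 1`, `k` a positive even integer (with `k < n`
if `n` is even), `F` a finite-dimensional real inner product space, and
`h : ℝⁿ → F` smooth with compact support,
`(∫ ‖Δ^{k/2}h‖² (1+‖x‖²)^k dx)^{1/2} ≥ c (∫ ‖h‖²/(1+‖x‖²)^k dx)^{1/2}`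
where `c = ∏_{j=1}^{k/2} (n+2j-2)|n-2j| = |n(2-n)(n+2)(4-n)⋯(n+k-2)(k-n)|`. -/
theorem weighted_laplacian_power_inequality (n k : ℕ) (hn : 1 ≤ n) (hk : Even k)
    (hk0 : 0 < k) (hkn : Even n → k < n) (F : Type*)
    [NormedAddCommGroup F] [InnerProductSpace ℝ F] [FiniteDimensional ℝ F]
    (h : EuclideanSpace ℝ (Fin n) → F)
    (hsmooth : ContDiff ℝ (⊤ : ℕ∞) h) (hsupp : HasCompactSupport h) :
    Real.sqrt (∫ x, ‖laplacian^[k / 2] h x‖ ^ 2 * (1 + ‖x‖ ^ 2) ^ k) ≥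
      (∏ j ∈ Finset.Icc 1 (k / 2), (((n : ℝ) + 2 * j - 2) * |(n : ℝ) - 2 * j|)) *
        Real.sqrt (∫ x, ‖h x‖ ^ 2 / (1 + ‖x‖ ^ 2) ^ k) := by
  obtain ⟨m, rfl⟩ := hk
  have e : m + m = 2 * m := by ring
  rw [e, show 2 * m / 2 = m by omega, WL.fm_eq]
  rw [e] at hkn hk0
  have hn' : n = 1 ∨ 3 ≤ n := by
    by_cases h2 : n = 2
    · subst h2; have := hkn ⟨1, rfl⟩; omega
    · omega
  have key := WL.main hn' m hkn F h hsmooth hsupp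
  have h0 := WL.fm_nonneg m n (Nat.cast_nonneg n)
  rw [ge_iff_le, ← Real.sqrt_sq h0, ← Real.sqrt_mul (sq_nonneg _)]
  exact Real.sqrt_le_sqrt key

end
end
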